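/- Let M be a σ-compact, non-compact, connected 2-manifold (possibly with boundary). A homeomorphism h of M belongs to the identity connected component 𝓗₀(M) of 𝓗(M) (with the Whitney topology) if and only if there exists an isotopy H : M × [0,1] → M from h to id_M with compact support, i.e., a continuous map H such that each H(·,t) is a homeomorphism of M, H(·,0) = h, H(·,1) = id_M, and there is a compact set K ⊆ M with H(x,t) = x for all x ∈ M \ K and t ∈ [0,1]. -/

import Mathlib

noncomputable section

open scoped Pointwise

/-- The Whitney topology on the homeomorphism group of a space `M`:
it is generated by the sets `{f | graph f ⊆ U}` where `U` runs over the open subsets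
of `M × M`. -/
def whitneyTopology (M : Type*) [TopologicalSpace M] : TopologicalSpace (M ≃ₜ M) :=
  TopologicalSpace.generateFrom
    {S : Set (M ≃ₜ M) | ∃ U : Set (M × M), IsOpen U ∧ S = {f : M ≃ₜ M | ∀ x : M, (x, f x) ∈ U}}

/-- We endow the homeomorphism group `𝓗(M)` with the Whitney topology. -/
instance (M : Type*) [TopologicalSpace M] : TopologicalSpace (M ≃ₜ M) := whitneyTopology M

/-- `𝓗_c(M)`: the set of compactly supported homeomorphisms of `M`. -/
def Hc (M : Type*) [TopologicalSpace M] : Set (M ≃ₜ M) :=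
  {f : M ≃ₜ M | IsCompact (closure {x : M | f x ≠ x})}

/-- `𝓗₀(M)`: the identity component of the homeomorphism group of `M` with
the Whitney topology. -/
def H0 (M : Type*) [TopologicalSpace M] : Set (M ≃ₜ M) :=
  connectedComponent (Homeomorph.refl M)

section

open Set Filter Topology Metric
open scoped NNReal

namespace WhitneyHomeo

/-! ### Extending maps by the identity -/

section Extend

variable {X Y : Type*} [TopologicalSpace X] [TopologicalSpace Y]

open Classical in
/-- Transport a self-map `φ` of `X` to `Y` along the partial homeomorphism `e`, extending it by
the identity outside the target of `e`. -/
def transport (e : OpenPartialHomeomorph X Y) (φ : X → X) (y : Y) : Y :=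
  if y ∈ e.target then e (φ (e.symm y)) else y

lemma transport_of_mem (e : OpenPartialHomeomorph X Y) (φ : X → X) {x : X} (hx : x ∈ e.source) :
    transport e φ (e x) = e (φ x) := by
  simp [transport, e.map_source hx, e.left_inv hx]

lemma transport_of_notMem_image (e : OpenPartialHomeomorph X Y) {φ : X → X} {B : Set X}
    (hφ : ∀ x ∉ B, φ x = x) {y : Y} (hy : y ∉ e '' B) : transport e φ y = y := by
  by_cases h : y ∈ e.target
  · have hB : e.symm y ∉ B := fun hB => hy ⟨_, hB, e.right_inv h⟩
    simp [transport, h, hφ _ hB]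
  · simp [transport, h]

lemma continuous_transport [T2Space Y] (e : OpenPartialHomeomorph X Y) {φ : X → X} {B : Set X}
    (hB : IsCompact B) (hBe : B ⊆ e.source) (hc : Continuous φ) (hφ : ∀ x ∉ B, φ x = x)
    (hmaps : MapsTo φ B B) : Continuous (transport e φ) := by
  have hms : MapsTo φ e.source e.source := fun x hx => by
    by_cases hxB : x ∈ B
    · exact hBe (hmaps hxB)
    · rwa [hφ x hxB]
  have hcl : IsClosed (e '' B) := (hB.image_of_continuousOn (e.continuousOn.mono hBe)).isClosed
  have h1 : ContinuousOn (transport e φ) e.target := by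
    have : ContinuousOn (fun y => e (φ (e.symm y))) e.target :=
      e.continuousOn.comp (hc.comp_continuousOn e.continuousOn_symm)
        (fun y hy => hms (e.map_target hy))
    exact this.congr fun y hy => by simp [transport, hy]
  have h2 : ContinuousOn (transport e φ) (e '' B)ᶜ :=
    continuousOn_id.congr fun y hy => transport_of_notMem_image e hφ hy
  have h3 := h1.union_of_isOpen h2 e.open_target hcl.isOpen_compl
  rw [← continuousOn_univ]
  refine h3.mono fun y _ => ?_
  by_cases h : y ∈ e '' B
  · obtain ⟨x, hx, rfl⟩ := h
    exact Or.inl (e.map_source (hBe hx))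
  · exact Or.inr h

lemma mapsTo_of_fixed_off {B : Set X} (g : X ≃ₜ X) (hg : ∀ x ∉ B, g x = x) : MapsTo g B B := by
  intro x hx
  by_contra h
  have : g (g x) = g x := hg _ h
  rw [g.injective this] at h
  exact h hx

lemma symm_fixed_off {B : Set X} (g : X ≃ₜ X) (hg : ∀ x ∉ B, g x = x) :
    ∀ x ∉ B, g.symm x = x := fun x hx => by
  rw [Homeomorph.symm_apply_eq, hg x hx]

lemma transport_comp (e : OpenPartialHomeomorph X Y) {φ ψ : X → X}
    (hms : MapsTo ψ e.source e.source) (hinv : ∀ x, φ (ψ x) = x) (y : Y) :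
    transport e φ (transport e ψ y) = y := by
  by_cases hy : y ∈ e.target
  · obtain ⟨x, hx, rfl⟩ := e.image_source_eq_target.symm ▸ hy
    rw [transport_of_mem e ψ hx, transport_of_mem e φ (hms hx), hinv]
  · simp [transport, hy]

lemma mapsTo_source (e : OpenPartialHomeomorph X Y) {B : Set X} (hBe : B ⊆ e.source) (g : X ≃ₜ X)
    (hg : ∀ x ∉ B, g x = x) : MapsTo g e.source e.source := fun x hx => by
  by_cases hxB : x ∈ B
  · exact hBe (mapsTo_of_fixed_off g hg hxB)
  · rwa [hg x hxB]

/-- Transport of a homeomorphism supported in a compact subset of the source of `e`. -/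
def transportHomeo [T2Space Y] (e : OpenPartialHomeomorph X Y) {B : Set X}
    (hB : IsCompact B) (hBe : B ⊆ e.source) (g : X ≃ₜ X) (hg : ∀ x ∉ B, g x = x) : Y ≃ₜ Y where
  toFun := transport e g
  invFun := transport e g.symm
  left_inv := transport_comp e (mapsTo_source e hBe g hg) (by simp)
  right_inv := transport_comp e (mapsTo_source e hBe g.symm (symm_fixed_off g hg)) (by simp)
  continuous_toFun := continuous_transport e hB hBe g.continuous hg (mapsTo_of_fixed_off g hg)
  continuous_invFun := continuous_transport e hB hBe g.symm.continuous (symm_fixed_off g hg)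
    (mapsTo_of_fixed_off g.symm (symm_fixed_off g hg))

@[simp] lemma transportHomeo_apply [T2Space Y] (e : OpenPartialHomeomorph X Y) {B : Set X}
    (hB : IsCompact B) (hBe : B ⊆ e.source) (g : X ≃ₜ X) (hg : ∀ x ∉ B, g x = x) (y : Y) :
    transportHomeo e hB hBe g hg y = transport e g y := rfl

open Classical in
/-- Restrict a homeomorphism preserving the open set `W` to `W`, extending it by the identity. -/
lemma exists_restrict (h : X ≃ₜ X) {W F : Set X} (hW : IsOpen W) (hF : IsClosed F) (hFW : F ⊆ W)
    (hfix : ∀ x ∈ W, x ∉ F → h x = x) (hWW : h '' W = W) :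
    ∃ g : X ≃ₜ X, (∀ x ∈ W, g x = h x) ∧ ∀ x ∉ W, g x = x := by
  have hmaps : ∀ x, x ∈ W ↔ h x ∈ W := fun x => by
    conv_rhs => rw [← hWW]
    exact (h.injective.mem_set_image).symm
  have cont : ∀ k : X → X, Continuous k → (∀ x ∈ W, x ∉ F → k x = x) →
      Continuous (fun x => if x ∈ W then k x else x) := by
    intro k hk hkf
    rw [← continuousOn_univ]
    have h1 : ContinuousOn (fun x => if x ∈ W then k x else x) W :=
      hk.continuousOn.congr fun x hx => by simp [hx]
    have h2 : ContinuousOn (fun x => if x ∈ W then k x else x) Fᶜ :=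
      continuousOn_id.congr fun x hx => by
        by_cases hxW : x ∈ W
        · simp [hxW, hkf x hxW hx]
        · simp [hxW]
    refine (h1.union_of_isOpen h2 hW hF.isOpen_compl).mono fun x _ => ?_
    by_cases hx : x ∈ F
    · exact Or.inl (hFW hx)
    · exact Or.inr hx
  have hmaps' : ∀ x, x ∈ W ↔ h.symm x ∈ W := fun x => by
    rw [hmaps (h.symm x), h.apply_symm_apply]
  refine ⟨{ toFun := fun x => if x ∈ W then h x else x
            invFun := fun x => if x ∈ W then h.symm x else x
            left_inv := fun x => ?_
            right_inv := fun x => ?_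
            continuous_toFun := cont h h.continuous hfix
            continuous_invFun := cont h.symm h.symm.continuous fun x hx hxF => ?_ }, ?_, ?_⟩
  · by_cases hx : x ∈ W
    · simp [hx, (hmaps x).1 hx]
    · simp [hx]
  · by_cases hx : x ∈ W
    · simp [hx, (hmaps' x).1 hx]
    · simp [hx]
  · rw [Homeomorph.symm_apply_eq, hfix x hx hxF]
  · intro x hx; show (if x ∈ W then h x else x) = h x; simp [hx]
  · intro x hx; show (if x ∈ W then h x else x) = x; simp [hx]

end Extend

/-! ### Compactly supported isotopies to the identity -/

section Isotopy

variable {M : Type*} [TopologicalSpace M]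

/-- `h` is isotopic to the identity through a compactly supported isotopy. -/
def IsotopicToId (h : M ≃ₜ M) : Prop :=
  ∃ F : M × unitInterval → M, Continuous F ∧
    (∀ t : unitInterval, ∃ g : M ≃ₜ M, ∀ x : M, F (x, t) = g x) ∧
    (∀ x : M, F (x, 0) = h x) ∧ (∀ x : M, F (x, 1) = x) ∧
    ∃ K : Set M, IsCompact K ∧ ∀ x : M, x ∉ K → ∀ t : unitInterval, F (x, t) = x

lemma IsotopicToId.refl : IsotopicToId (Homeomorph.refl M) :=
  ⟨Prod.fst, continuous_fst, fun _ => ⟨Homeomorph.refl M, fun _ => rfl⟩, fun _ => rfl,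
    fun _ => rfl, ∅, isCompact_empty, fun _ _ _ => rfl⟩

lemma IsotopicToId.of_eq_id {h : M ≃ₜ M} (hh : ∀ x, h x = x) : IsotopicToId h := by
  rw [show h = Homeomorph.refl M from Homeomorph.ext hh]; exact .refl

lemma IsotopicToId.trans {g h : M ≃ₜ M} (hg : IsotopicToId g) (hh : IsotopicToId h) :
    IsotopicToId (g.trans h) := by
  obtain ⟨F, hF, hF', h0, h1, K, hK, hFK⟩ := hg
  obtain ⟨F₂, hF₂, hF₂', h0₂, h1₂, K₂, hK₂, hFK₂⟩ := hh
  refine ⟨fun p => F₂ (F p, p.2), hF₂.comp (hF.prodMk continuous_snd), fun t => ?_, fun x => ?_,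
    fun x => ?_, K ∪ K₂, hK.union hK₂, fun x hx t => ?_⟩
  · obtain ⟨a, ha⟩ := hF' t
    obtain ⟨b, hb⟩ := hF₂' t
    exact ⟨a.trans b, fun x => by simp [ha, hb]⟩
  · simp [h0, h0₂]
  · simp [h1, h1₂]
  · rw [mem_union, not_or] at hx
    simp only [hFK x hx.1 t, hFK₂ x hx.2 t]

lemma IsotopicToId.symm {g : M ≃ₜ M} (hg : IsotopicToId g) : IsotopicToId g.symm := by
  obtain ⟨F, hF, hF', h0, h1, K, hK, hFK⟩ := hg
  have hgK : ∀ x ∉ K, g x = x := fun x hx => by rw [← h0, hFK x hx]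
  refine ⟨fun p => F (g.symm p.1, unitInterval.symm p.2), by fun_prop, fun t => ?_, fun x => ?_,
    fun x => ?_, K, hK, fun x hx t => ?_⟩
  · obtain ⟨a, ha⟩ := hF' (unitInterval.symm t)
    exact ⟨g.symm.trans a, fun x => by simp [ha]⟩
  · simp [h1]
  · simp [h0]
  · simp only [symm_fixed_off g hgK x hx, hFK x hx]

lemma IsotopicToId.of_trans {g h : M ≃ₜ M} (hg : IsotopicToId g)
    (hgh : IsotopicToId (h.trans g)) : IsotopicToId h := by
  have := hgh.trans hg.symm
  rwa [show (h.trans g).trans g.symm = h from Homeomorph.ext fun x => by simp] at this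

end Isotopy

/-! ### The Alexander trick -/

section Alexander

variable {E : Type*} [MetricSpace E] [Zero E] [MulActionWithZero ℝ≥0 E]
  [IsBoundedSMul ℝ≥0 E]

lemma smul_mem_closedBall {s : ℝ≥0} {p : E} {r : ℝ} (hs : s ≤ 1) (hp : p ∈ closedBall (0 : E) r) :
    s • p ∈ closedBall (0 : E) r := by
  rw [mem_closedBall] at *
  have h := dist_smul_pair s p 0
  rw [smul_zero, NNReal.dist_eq] at h
  have hs' : (s : ℝ) ≤ 1 := hs
  simp only [NNReal.coe_zero, sub_zero, NNReal.abs_eq] at h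
  nlinarith [dist_nonneg (x := p) (y := 0), s.2]

lemma dist_smul_smul_le (s : ℝ≥0) (p q : E) : dist (s • p) (s • q) ≤ s * dist p q := by
  simpa [NNReal.dist_eq] using dist_smul_pair s p q

open Classical in
/-- The Alexander isotopy, parametrised by the scaling factor. -/
def alexander (φ : E → E) (s : ℝ≥0) (p : E) : E := if s = 0 then p else s • φ (s⁻¹ • p)

lemma alexander_fixed_off {φ : E → E} {r : ℝ} (hφ : ∀ x ∉ closedBall (0 : E) r, φ x = x)
    {s : ℝ≥0} (hs : s ≤ 1) {p : E} (hp : p ∉ closedBall (0 : E) r) : alexander φ s p = p := by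
  by_cases h : s = 0
  · simp [alexander, h]
  · rw [alexander, if_neg h, hφ, smul_inv_smul₀ h]
    intro h'
    apply hp
    simpa [smul_inv_smul₀ h] using smul_mem_closedBall hs h'

lemma dist_alexander_le {φ : E → E} {C : ℝ} (hφ : ∀ x, dist (φ x) x ≤ C) (s : ℝ≥0) (p : E) :
    dist (alexander φ s p) p ≤ s * C := by
  by_cases h : s = 0
  · simp [alexander, h]
  · rw [alexander, if_neg h]
    nth_rewrite 2 [← smul_inv_smul₀ h p]
    exact (dist_smul_smul_le s _ _).trans (by gcongr; exact hφ _)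

lemma continuous_alexander {φ : E → E} {C : ℝ} (hc : Continuous φ) (hφ : ∀ x, dist (φ x) x ≤ C) :
    Continuous fun q : E × ℝ≥0 => alexander φ q.2 q.1 := by
  rw [continuous_iff_continuousAt]
  rintro ⟨p, s⟩
  by_cases h : s = 0
  · subst h
    rw [ContinuousAt]
    have h0 : alexander φ (0 : ℝ≥0) p = p := by simp [alexander]
    simp only [h0]
    have h1 : Tendsto (fun q : E × ℝ≥0 => (q.2 : ℝ) * C) (𝓝 (p, 0)) (𝓝 0) := by
      have : Continuous fun q : E × ℝ≥0 => (q.2 : ℝ) * C := by fun_prop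
      simpa using this.tendsto (p, 0)
    have h2 : Tendsto (fun q : E × ℝ≥0 => dist (alexander φ q.2 q.1) q.1) (𝓝 (p, 0)) (𝓝 0) :=
      squeeze_zero (fun _ => dist_nonneg) (fun q => dist_alexander_le hφ q.2 q.1) h1
    rw [tendsto_iff_dist_tendsto_zero]
    have h3 : Tendsto (fun q : E × ℝ≥0 => dist q.1 p) (𝓝 (p, 0)) (𝓝 0) := by
      have : Continuous fun q : E × ℝ≥0 => dist q.1 p := by fun_prop
      simpa using this.tendsto (p, 0)
    exact squeeze_zero (fun _ => dist_nonneg) (fun q => dist_triangle _ q.1 _)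
      (by simpa using h2.add h3)
  · have h1 : ContinuousAt (fun q : E × ℝ≥0 => q.2 • φ (q.2⁻¹ • q.1)) (p, s) := by
      have hinv : ContinuousAt (fun q : E × ℝ≥0 => q.2⁻¹) (p, s) :=
        continuousAt_snd.inv₀ h
      exact continuousAt_snd.smul
        (hc.continuousAt.comp (f := fun q : E × ℝ≥0 => q.2⁻¹ • q.1) (hinv.smul continuousAt_fst))
    refine h1.congr ?_
    filter_upwards [continuousAt_snd.eventually_ne (x := (p, s)) h] with q hq
    simp [alexander, hq]

lemma exists_homeomorph_alexander (g : E ≃ₜ E) (s : ℝ≥0) :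
    ∃ g' : E ≃ₜ E, ∀ p, g' p = alexander g s p := by
  by_cases h : s = 0
  · exact ⟨Homeomorph.refl E, fun p => by simp [alexander, h]⟩
  · refine ⟨((Homeomorph.smulOfNeZero (α := E) s h).symm.trans g).trans
      (Homeomorph.smulOfNeZero s h), fun p => ?_⟩
    simp only [alexander, if_neg h]
    rfl

variable [ProperSpace E] {M : Type*} [TopologicalSpace M] [T2Space M]

lemma isotopicToId_transportHomeo (e : OpenPartialHomeomorph E M) {r : ℝ}
    (hr : closedBall (0 : E) r ⊆ e.source) (g : E ≃ₜ E)
    (hg : ∀ x ∉ closedBall (0 : E) r, g x = x) :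
    IsotopicToId (transportHomeo e (isCompact_closedBall _ _) hr g hg) := by
  have hC : ∀ x, dist (g x) x ≤ 2 * max r 0 := fun x => by
    by_cases hx : x ∈ closedBall (0 : E) r
    · have h1 := mem_closedBall.1 hx
      have h2 := mem_closedBall.1 (mapsTo_of_fixed_off g hg hx)
      have := dist_triangle_right (g x) x 0
      linarith [le_max_left r 0]
    · rw [hg x hx, dist_self]; positivity
  let σ : unitInterval → ℝ≥0 := fun t => ⟨1 - t, by linarith [t.2.2]⟩
  have hσ : Continuous σ := by unfold σ; fun_prop
  have hσ1 : ∀ t, σ t ≤ 1 := fun t => by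
    rw [← NNReal.coe_le_coe]
    show (1 : ℝ) - t ≤ 1
    linarith [t.2.1]
  have hσ0 : σ 0 = 1 := Subtype.ext (by simp [σ])
  have hσ1' : σ 1 = 0 := Subtype.ext (by simp [σ])
  let A : E × unitInterval → E := fun q => alexander g (σ q.2) q.1
  have hA : Continuous A := (continuous_alexander g.continuous hC).comp
    (continuous_fst.prodMk (hσ.comp continuous_snd))
  have hoff : ∀ t, ∀ x ∉ closedBall (0 : E) r, alexander g (σ t) x = x :=
    fun t x hx => alexander_fixed_off hg (hσ1 t) hx
  have hhom : ∀ t, ∃ g' : E ≃ₜ E, ⇑g' = alexander g (σ t) := fun t => by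
    obtain ⟨g', h⟩ := exists_homeomorph_alexander g (σ t)
    exact ⟨g', funext h⟩
  let e' := e.prod (OpenPartialHomeomorph.refl unitInterval)
  have hcont : Continuous (transport e' fun q => (A q, q.2)) := by
    refine continuous_transport e' (B := closedBall (0 : E) r ×ˢ univ)
      ((isCompact_closedBall _ _).prod isCompact_univ) ?_ (hA.prodMk continuous_snd) ?_ ?_
    · rintro ⟨p, t⟩ h
      simpa [e'] using hr h.1
    · rintro ⟨p, t⟩ h
      have : p ∉ closedBall (0 : E) r := fun hp => h ⟨hp, mem_univ _⟩
      exact Prod.ext (hoff t p this) rfl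
    · rintro ⟨p, t⟩ h
      refine ⟨?_, mem_univ _⟩
      obtain ⟨g', h'⟩ := hhom t
      show alexander g (σ t) p ∈ _
      rw [← h']
      exact mapsTo_of_fixed_off g' (by rw [h']; exact hoff t) h.1
  refine ⟨fun q => transport e (fun p => A (p, q.2)) q.1, ?_, fun t => ?_, fun x => ?_,
    fun x => ?_, e '' closedBall 0 r,
    (isCompact_closedBall _ _).image_of_continuousOn (e.continuousOn.mono hr), fun x hx t => ?_⟩
  · refine (continuous_fst.comp hcont).congr fun q => ?_
    by_cases hq : q.1 ∈ e.target
    · simp [transport, e', hq]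
    · simp [transport, e', hq]
  · obtain ⟨g', h'⟩ := hhom t
    refine ⟨transportHomeo e (isCompact_closedBall _ _) hr g' (by rw [h']; exact hoff t),
      fun x => ?_⟩
    simp only [transportHomeo_apply, h', A]
  · simp only [A, hσ0, alexander, transportHomeo_apply, transport]
    simp
  · simp only [A, hσ1', alexander, transport]
    simp only [if_true]
    split_ifs with h
    · exact e.right_inv h
    · rfl
  · exact transport_of_notMem_image e (hoff t) hx

/-- **Alexander trick**: a homeomorphism supported in the image of a ball is isotopic to the
identity. -/
lemma isotopicToId_of_fixed_off_image_closedBall (e : OpenPartialHomeomorph E M) {r : ℝ}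
    (hr : closedBall (0 : E) r ⊆ e.source) (g : M ≃ₜ M)
    (hg : ∀ y ∉ e '' closedBall (0 : E) r, g y = y) : IsotopicToId g := by
  have hB : IsCompact (e '' closedBall (0 : E) r) :=
    (isCompact_closedBall _ _).image_of_continuousOn (e.continuousOn.mono hr)
  have hBe : e '' closedBall (0 : E) r ⊆ e.symm.source := by
    rintro _ ⟨x, hx, rfl⟩
    exact e.map_source (hr hx)
  have himg : e.symm '' (e '' closedBall (0 : E) r) = closedBall 0 r :=
    e.symm_image_image_of_subset_source hr
  let gE := transportHomeo e.symm hB hBe g hg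
  have hgE : ∀ x ∉ closedBall (0 : E) r, gE x = x := fun x hx =>
    transport_of_notMem_image e.symm hg (by rwa [himg])
  have := isotopicToId_transportHomeo e hr gE hgE
  convert this
  ext y
  by_cases hy : y ∈ e.target
  · obtain ⟨x, hx, rfl⟩ := e.image_source_eq_target.symm ▸ hy
    rw [transportHomeo_apply, transport_of_mem e _ hx]
    have h1 : gE x = e.symm (g (e x)) := by
      have := transport_of_mem e.symm g hy
      rw [e.left_inv hx] at this
      exact this
    rw [h1, e.right_inv]
    exact mapsTo_source e.symm hBe g hg hy
  · rw [transportHomeo_apply, transport, if_neg hy, hg]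
    intro hy'
    exact hy (hBe hy')

end Alexander

/-! ### Periodic extension of almost-identity embeddings of a strip -/

section Periodic

lemma subset_image_of_dist_le {E : Type*} [MetricSpace E] [ProperSpace E] {f : E → E}
    {S P : Set E} {ε ε' : ℝ} (hε : ε < ε') (hP : IsPreconnected P)
    (hloc : ∀ p ∈ S, map f (𝓝 p) = 𝓝 (f p)) (hS : IsOpen S) (hd : ∀ p ∈ S, dist (f p) p ≤ ε)
    (hPS : ∀ y ∈ P, closedBall y ε' ⊆ S) (hne : (P ∩ f '' S).Nonempty) : P ⊆ f '' S := by
  have hopen : IsOpen (f '' S) := by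
    rw [isOpen_iff_mem_nhds]
    rintro _ ⟨p, hp, rfl⟩
    rw [← hloc p hp]
    exact image_mem_map (hS.mem_nhds hp)
  refine hP.subset_of_closure_inter_subset hopen hne ?_
  rintro y ⟨hy, hyP⟩
  have hK : IsCompact (f '' closedBall y ε') :=
    (isCompact_closedBall y ε').image_of_continuousOn fun p hp =>
      (show ContinuousAt f p from (hloc p (hPS y hyP hp)).le).continuousWithinAt
  have hcl : y ∈ closure (f '' closedBall y ε') := by
    rw [Metric.mem_closure_iff] at hy ⊢
    intro r hr
    obtain ⟨_, ⟨p, hp, rfl⟩, h⟩ := hy (min r (ε' - ε)) (lt_min hr (by linarith))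
    refine ⟨f p, ⟨p, ?_, rfl⟩, h.trans_le (min_le_left _ _)⟩
    have h1 := h.trans_le (min_le_right _ _)
    have h2 := hd p hp
    rw [mem_closedBall]
    have := dist_triangle_left p y (f p)
    rw [dist_comm y] at h1
    linarith
  rw [hK.isClosed.closure_eq] at hcl
  exact image_mono (hPS y hyP) hcl

/-- The homeomorphism of the line which is the identity on `(-∞, -3/4]` and the translation by
`1` on `[-1/4, ∞)`. -/
def lineShift : ℝ ≃ₜ ℝ where
  toFun y := y + max 0 (min 1 (2 * y + 3 / 2))
  invFun z := z - max 0 (min 1 (2 / 3 * z + 1 / 2))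
  left_inv y := by
    beta_reduce
    rcases le_total (2 * y + 3 / 2) 0 with h | h
    · rw [min_eq_right (by linarith), max_eq_left h, min_eq_right (by linarith),
        max_eq_left (by linarith)]; ring
    · rcases le_total (2 * y + 3 / 2) 1 with h' | h'
      · rw [min_eq_right h', max_eq_right h, min_eq_right (by linarith),
          max_eq_right (by linarith)]; ring
      · rw [min_eq_left h', max_eq_right zero_le_one, min_eq_left (by linarith),
          max_eq_right zero_le_one]; ring
  right_inv z := by
    beta_reduce
    rcases le_total (2 / 3 * z + 1 / 2) 0 with h | h
    · rw [min_eq_right (by linarith), max_eq_left h, min_eq_right (by linarith),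
        max_eq_left (by linarith)]; ring
    · rcases le_total (2 / 3 * z + 1 / 2) 1 with h' | h'
      · rw [min_eq_right h', max_eq_right h, min_eq_right (by linarith),
          max_eq_right (by linarith)]; ring
      · rw [min_eq_left h', max_eq_right zero_le_one, min_eq_left (by linarith),
          max_eq_right zero_le_one]; ring
  continuous_toFun := by fun_prop
  continuous_invFun := by fun_prop

lemma lineShift_of_le {y : ℝ} (hy : y ≤ -(3 / 4)) : lineShift y = y := by
  show y + max 0 (min 1 (2 * y + 3 / 2)) = y
  rw [min_eq_right (by linarith), max_eq_left (by linarith), add_zero]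

lemma lineShift_of_ge {y : ℝ} (hy : -(1 / 4) ≤ y) : lineShift y = y + 1 := by
  show y + max 0 (min 1 (2 * y + 3 / 2)) = y + 1
  rw [min_eq_left (by linarith), max_eq_right zero_le_one]

lemma lineShift_mem (y : ℝ) : y ≤ lineShift y ∧ lineShift y ≤ y + 1 := by
  show y ≤ y + max 0 (min 1 (2 * y + 3 / 2)) ∧ y + max 0 (min 1 (2 * y + 3 / 2)) ≤ y + 1
  constructor
  · linarith [le_max_left 0 (min 1 (2 * y + 3 / 2))]
  · linarith [max_le zero_le_one (min_le_left 1 (2 * y + 3 / 2))]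

lemma dist_lineShift_symm_le (y z : ℝ) :
    dist (lineShift.symm y) (lineShift.symm z) ≤ dist y z := by
  have key : ∀ a b : ℝ, a ≤ b → lineShift.symm a ≤ lineShift.symm b ∧
      lineShift.symm b - lineShift.symm a ≤ b - a := by
    intro a b hab
    show a - max 0 (min 1 (2 / 3 * a + 1 / 2)) ≤ b - max 0 (min 1 (2 / 3 * b + 1 / 2)) ∧
      b - max 0 (min 1 (2 / 3 * b + 1 / 2)) - (a - max 0 (min 1 (2 / 3 * a + 1 / 2))) ≤ b - a
    have h1 : max 0 (min 1 (2 / 3 * a + 1 / 2)) ≤ max 0 (min 1 (2 / 3 * b + 1 / 2)) := by gcongr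
    have h2 : max 0 (min 1 (2 / 3 * b + 1 / 2)) ≤
        max 0 (min 1 (2 / 3 * a + 1 / 2)) + (b - a) := by
      refine max_le (by linarith [le_max_left 0 (min 1 (2 / 3 * a + 1 / 2))]) ?_
      have h3 := le_max_right 0 (min 1 (2 / 3 * a + 1 / 2))
      rcases le_total 1 (2 / 3 * a + 1 / 2) with h | h
      · rw [min_eq_left h] at h3 ⊢
        linarith [min_le_left 1 (2 / 3 * b + 1 / 2)]
      · rw [min_eq_right h] at h3 ⊢
        linarith [min_le_right 1 (2 / 3 * b + 1 / 2)]
    constructor <;> linarith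
  rw [Real.dist_eq, Real.dist_eq]
  rcases le_total y z with h | h
  · obtain ⟨h1, h2⟩ := key y z h
    rw [abs_sub_comm, abs_sub_comm y, abs_of_nonneg (by linarith), abs_of_nonneg (by linarith)]
    exact h2
  · obtain ⟨h1, h2⟩ := key z y h
    rw [abs_of_nonneg (by linarith), abs_of_nonneg (by linarith)]
    exact h2

variable {X : Type*} [MetricSpace X]

/-- Vertical translation of `X × ℝ`. -/
def vtrans (X : Type*) [TopologicalSpace X] (a : ℝ) : X × ℝ ≃ₜ X × ℝ :=
  (Homeomorph.refl X).prodCongr (Homeomorph.addRight a)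

lemma vtrans_apply (a : ℝ) (p : X × ℝ) : vtrans X a p = (p.1, p.2 + a) := rfl

lemma dist_vtrans (a : ℝ) (p q : X × ℝ) : dist (vtrans X a p) (vtrans X a q) = dist p q := by
  simp [vtrans_apply, Prod.dist_eq]

lemma vtrans_vtrans (a b : ℝ) (p : X × ℝ) : vtrans X a (vtrans X b p) = vtrans X (b + a) p := by
  simp [vtrans_apply, add_assoc]

lemma vtrans_zero (p : X × ℝ) : vtrans X 0 p = p := by simp [vtrans_apply]

lemma abs_snd_sub_le_dist (p q : X × ℝ) : |p.2 - q.2| ≤ dist p q := by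
  rw [← Real.dist_eq]; exact le_max_right _ _

/-- Gluing step of the periodic extension: on a fundamental domain one finds a map which agrees
with `f` near the top and with the translated copy of `f` near the bottom. -/
lemma exists_fundamental_domain_map [ProperSpace X] [PreconnectedSpace X] [Nonempty X]
    {f : X × ℝ → X × ℝ}
    {ε : ℝ} (hε : ε ≤ 1 / 100) (hloc : ∀ p : X × ℝ, |p.2| < 2 → map f (𝓝 p) = 𝓝 (f p))
    (hinj : InjOn f {p | |p.2| < 2}) (hd : ∀ p : X × ℝ, |p.2| < 2 → dist (f p) p ≤ ε) :
    ∃ F : X × ℝ → X × ℝ,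
      (∀ p : X × ℝ, p.2 ∈ Ioo (-(6 / 5)) (1 / 5 : ℝ) → map F (𝓝 p) = 𝓝 (F p)) ∧
      InjOn F {p | p.2 ∈ Ioo (-(6 / 5)) (1 / 5 : ℝ)} ∧
      (∀ p : X × ℝ, p.2 ∈ Ioo (-(6 / 5)) (1 / 5 : ℝ) → dist (F p) p ≤ 3 * ε) ∧
      (∀ p : X × ℝ, p.2 ∈ Ioo (-(1 / 5)) (1 / 5 : ℝ) → F p = f p) ∧
      (∀ p : X × ℝ, p.2 ∈ Ioo (-(6 / 5)) (-(4 / 5) : ℝ) →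
        F p = vtrans X (-1) (f (vtrans X 1 p))) ∧
      ∀ x, (∀ t : ℝ, |t| < 2 → f (x, t) = (x, t)) →
        ∀ t ∈ Ioo (-(6 / 5)) (1 / 5 : ℝ), F (x, t) = (x, t) := by
  set S : Set (X × ℝ) := {p | |p.2| < 2} with hSdef
  have hS : IsOpen S := isOpen_lt (by fun_prop) (by fun_prop)
  set P : Set (X × ℝ) := univ ×ˢ Ioo (-(19 / 10)) (19 / 10 : ℝ) with hPdef
  have hP : IsPreconnected P := isPreconnected_univ.prod isPreconnected_Ioo
  have hcov : P ⊆ f '' S := by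
    refine subset_image_of_dist_le (ε := ε) (ε' := 1 / 20) (by linarith) hP
      (fun p hp => hloc p hp) hS (fun p hp => hd p hp) ?_ ?_
    · rintro y ⟨-, hy⟩ p hp
      have h1 := (abs_snd_sub_le_dist p y).trans (mem_closedBall.1 hp)
      rw [abs_le] at h1
      show |p.2| < 2
      rw [abs_lt]
      constructor <;> linarith [hy.1, hy.2]
    · obtain ⟨x⟩ := ‹Nonempty X›
      have h0 : ((x, 0) : X × ℝ) ∈ S := by simp [hSdef]
      refine ⟨f (x, 0), ⟨mem_univ _, ?_⟩, ⟨_, h0, rfl⟩⟩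
      have h1 := (abs_snd_sub_le_dist _ _).trans (hd _ h0)
      rw [abs_le] at h1
      simp only [sub_zero] at h1
      constructor <;> linarith
  have hcov' : ∀ p, p ∈ P → ∃ q, q ∈ S ∧ f q = p := fun p hp => hcov hp
  choose! k hkS hfk using hcov'
  have hkf : ∀ p ∈ S, f p ∈ P → k (f p) = p := fun p hp hfp =>
    hinj (hkS _ hfp) hp (hfk _ hfp)
  have hkloc : ∀ p ∈ P, map k (𝓝 p) = 𝓝 (k p) := by
    intro p hp
    have hPo : IsOpen P := isOpen_univ.prod isOpen_Ioo
    have hev : k ∘ f =ᶠ[𝓝 (k p)] id := by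
      have hc : ContinuousAt f (k p) := (hloc _ (hkS _ hp)).le
      filter_upwards [hS.mem_nhds (hkS _ hp), hc.preimage_mem_nhds
        (by rw [hfk _ hp]; exact hPo.mem_nhds hp)] with q hq hq'
      exact hkf q hq hq'
    conv_lhs => rw [← hfk _ hp, ← hloc _ (hkS _ hp), Filter.map_map, Filter.map_congr hev, map_id]
  have hkd : ∀ p ∈ P, dist (k p) p ≤ ε := fun p hp => by
    have := hd _ (hkS _ hp)
    rwa [hfk _ hp, dist_comm] at this
  have hkinj : InjOn k P := fun p hp q hq h => by rw [← hfk _ hp, ← hfk _ hq, h]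
  let τ : X × ℝ ≃ₜ X × ℝ := (Homeomorph.refl X).prodCongr lineShift
  have hτ : ∀ p : X × ℝ, τ p = (p.1, lineShift p.2) := fun _ => rfl
  have hτs : ∀ p : X × ℝ, τ.symm p = (p.1, lineShift.symm p.2) := fun _ => rfl
  have hτd : ∀ p q, dist (τ.symm p) (τ.symm q) ≤ dist p q := fun p q => by
    rw [hτs, hτs, Prod.dist_eq, Prod.dist_eq]
    exact max_le_max le_rfl (dist_lineShift_symm_le _ _)
  set W : Set (X × ℝ) := {p | p.2 ∈ Ioo (-(6 / 5)) (1 / 5 : ℝ)} with hW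
  -- positions of the intermediate points
  have m1 : ∀ p ∈ W, p ∈ S := fun p hp => by
    show |p.2| < 2
    rw [abs_lt]; constructor <;> linarith [hp.1, hp.2]
  have m2 : ∀ p ∈ W, |(f p).2 - p.2| ≤ ε := fun p hp =>
    (abs_snd_sub_le_dist _ _).trans (hd _ (m1 p hp))
  have m3 : ∀ p ∈ W, τ (f p) ∈ P := fun p hp => by
    have h := abs_le.1 (m2 p hp)
    refine ⟨mem_univ _, ?_⟩
    rw [hτ]
    have h' := lineShift_mem (f p).2
    constructor <;> simp only <;> linarith [hp.1, hp.2]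
  have m4 : ∀ p ∈ W, dist (τ.symm (k (τ (f p)))) (f p) ≤ ε := fun p hp => by
    have h := hτd (k (τ (f p))) (τ (f p))
    rw [τ.symm_apply_apply] at h
    exact h.trans (hkd _ (m3 p hp))
  have m5 : ∀ p ∈ W, vtrans X 1 (τ.symm (k (τ (f p)))) ∈ S := fun p hp => by
    have h1 := abs_le.1 (m2 p hp)
    have h2 := abs_le.1 ((abs_snd_sub_le_dist _ _).trans (m4 p hp))
    show |(τ.symm (k (τ (f p)))).2 + (1 : ℝ)| < 2
    rw [abs_lt]
    constructor <;> linarith [hp.1, hp.2]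
  refine ⟨fun p => vtrans X (-1) (f (vtrans X 1 (τ.symm (k (τ (f p)))))), ?_, ?_, ?_, ?_, ?_, ?_⟩
  · intro p hp
    have e1 : map f (𝓝 p) = 𝓝 (f p) := hloc p (m1 p hp)
    have e2 : map τ (𝓝 (f p)) = 𝓝 (τ (f p)) := τ.map_nhds_eq _
    have e3 := hkloc _ (m3 p hp)
    have e4 : map τ.symm (𝓝 (k (τ (f p)))) = _ := τ.symm.map_nhds_eq _
    have e5 : map (vtrans X 1) (𝓝 (τ.symm (k (τ (f p))))) = _ := (vtrans X 1).map_nhds_eq _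
    have e6 := hloc _ (m5 p hp)
    have e7 : map (vtrans X (-1)) (𝓝 (f (vtrans X 1 (τ.symm (k (τ (f p))))))) = _ :=
      (vtrans X (-1)).map_nhds_eq _
    rw [← e7, ← e6, ← e5, ← e4, ← e3, ← e2, ← e1]
    simp only [Filter.map_map]
    rfl
  · intro p hp q hq h
    exact hinj (m1 p hp) (m1 q hq) (τ.injective (hkinj (m3 p hp) (m3 q hq) (τ.symm.injective
      ((vtrans X 1).injective (hinj (m5 p hp) (m5 q hq) ((vtrans X (-1)).injective h))))))
  · intro p hp
    have h1 := hd _ (m1 p hp)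
    have h2 := m4 p hp
    have h3 := hd _ (m5 p hp)
    rw [← dist_vtrans (-1), vtrans_vtrans (-1) 1, add_neg_cancel, vtrans_zero] at h3
    have := dist_triangle4 (vtrans X (-1) (f (vtrans X 1 (τ.symm (k (τ (f p)))))))
      (τ.symm (k (τ (f p)))) (f p) p
    linarith
  · intro p hp
    have hpW : p ∈ W := ⟨by linarith [hp.1], hp.2⟩
    have h1 := abs_le.1 (m2 p hpW)
    have hT : τ (f p) = vtrans X 1 (f p) := by
      rw [hτ, lineShift_of_ge (by linarith [hp.1])]; rfl
    have h2 := abs_le.1 ((abs_snd_sub_le_dist _ _).trans (hkd _ (m3 p hpW)))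
    have h3 : (τ (f p)).2 = (f p).2 + 1 := by rw [hT]; rfl
    have key : ∀ z : X × ℝ, 3 / 4 ≤ z.2 → τ.symm z = vtrans X (-1) z := fun z hz => by
      rw [Homeomorph.symm_apply_eq, hτ, vtrans_apply, lineShift_of_ge (by simp only; linarith)]
      simp
    have hT' := key (k (τ (f p))) (by linarith [hp.1])
    simp only
    rw [hT', vtrans_vtrans, neg_add_cancel, vtrans_zero, hfk _ (m3 p hpW), hT, vtrans_vtrans,
      add_neg_cancel, vtrans_zero]
  · intro p hp
    have hpW : p ∈ W := ⟨hp.1, by linarith [hp.2]⟩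
    have h1 := abs_le.1 (m2 p hpW)
    have hT : τ (f p) = f p := by
      rw [hτ, lineShift_of_le (by linarith [hp.2])]
    have hfP : f p ∈ P := by rw [← hT]; exact m3 p hpW
    have hT' : τ.symm p = p := by
      rw [Homeomorph.symm_apply_eq, hτ, lineShift_of_le (by linarith [hp.2])]
    simp only
    rw [hT, hkf p (m1 p hpW) hfP, hT']
  · intro x hx t ht
    have h1 : f (x, t) = (x, t) := hx t (m1 (x, t) ht)
    have hP1 := m3 (x, t) ht
    rw [h1] at hP1
    have h2 : k (τ (x, t)) = τ (x, t) := by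
      have hS' : τ (x, t) ∈ S := by
        show |(τ (x, t)).2| < 2
        rw [abs_lt]
        constructor <;> linarith [hP1.2.1, hP1.2.2]
      have h3 : f (τ (x, t)) = τ (x, t) := hx _ hS'
      have h4 := hkf _ hS' (by rw [h3]; exact hP1)
      rwa [h3] at h4
    have h5 := m5 (x, t) ht
    simp only
    rw [h1, h2, τ.symm_apply_apply] at h5 ⊢
    rw [vtrans_apply 1] at h5 ⊢
    rw [hx _ h5, vtrans_apply]
    simp

/-- An embedding of a strip close to the identity agrees, on a thinner strip, with a
homeomorphism at bounded distance from the identity. -/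
lemma exists_periodic_extension [ProperSpace X] [PreconnectedSpace X] [Nonempty X]
    {f : X × ℝ → X × ℝ}
    {ε : ℝ} (hε : ε ≤ 1 / 100) (hloc : ∀ p : X × ℝ, |p.2| < 2 → map f (𝓝 p) = 𝓝 (f p))
    (hinj : InjOn f {p | |p.2| < 2}) (hd : ∀ p : X × ℝ, |p.2| < 2 → dist (f p) p ≤ ε) :
    ∃ H : X × ℝ ≃ₜ X × ℝ, (∀ p, dist (H p) p ≤ 3 * ε) ∧
      (∀ p : X × ℝ, |p.2| < 1 / 5 → H p = f p) ∧
      ∀ x, (∀ t : ℝ, |t| < 2 → f (x, t) = (x, t)) → ∀ t, H (x, t) = (x, t) := by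
  obtain ⟨F, hFloc, hFinj, hFd, htop, hbot, hFid⟩ :=
    exists_fundamental_domain_map hε hloc hinj hd
  let Fn : ℤ → X × ℝ → X × ℝ := fun n p => vtrans X n (F (vtrans X (-n) p))
  let H : X × ℝ → X × ℝ := fun p => Fn ⌈p.2⌉ p
  have hstep : ∀ (n : ℤ) (p : X × ℝ), p.2 - n ∈ Ioo (-(1 / 5)) (1 / 5 : ℝ) →
      Fn n p = Fn (n + 1) p := by
    intro n p hp
    have h1 : F (vtrans X (-n) p) = f (vtrans X (-n) p) := htop _ hp
    have h2 := hbot (vtrans X (-(n + 1 : ℤ)) p) (by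
      simp only [vtrans_apply]; push_cast; constructor <;> linarith [hp.1, hp.2])
    simp only [Fn]
    rw [h1, h2, vtrans_vtrans, vtrans_vtrans]
    congr 3 <;> push_cast <;> ring_nf
  have hwin : ∀ (n : ℤ) (p : X × ℝ), p.2 - n ∈ Ioo (-(6 / 5)) (1 / 5 : ℝ) → H p = Fn n p := by
    intro n p hp
    have h1 := Int.le_ceil p.2
    have h2 := Int.ceil_lt_add_one p.2
    have h3 : ⌈p.2⌉ < n + 2 := by
      rify; linarith [hp.2]
    have h4 : n - 2 < ⌈p.2⌉ := by
      rify; linarith [hp.1]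
    have h5 : ⌈p.2⌉ = n - 1 ∨ ⌈p.2⌉ = n ∨ ⌈p.2⌉ = n + 1 := by omega
    show Fn ⌈p.2⌉ p = Fn n p
    rcases h5 with h | h | h
    · rw [h] at h1 h2 ⊢
      push_cast at h1 h2
      have := hstep (n - 1) p (by push_cast; constructor <;> linarith [hp.1])
      rwa [sub_add_cancel] at this
    · rw [h]
    · rw [h] at h1 h2 ⊢
      push_cast at h1 h2
      exact (hstep n p (by constructor <;> linarith [hp.2])).symm
  have hbase : ∀ p : X × ℝ, p.2 - (⌈p.2⌉ : ℤ) ∈ Ioc (-1) (0 : ℝ) := fun p => by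
    constructor <;> linarith [Int.le_ceil p.2, Int.ceil_lt_add_one p.2]
  have hHd : ∀ p, dist (H p) p ≤ 3 * ε := by
    intro p
    have h := hFd (vtrans X (-(⌈p.2⌉ : ℤ)) p) (by
      have := hbase p
      constructor <;> simp only [vtrans_apply] <;> linarith [this.1, this.2])
    rw [← dist_vtrans ((⌈p.2⌉ : ℤ) : ℝ), vtrans_vtrans _ _ p, neg_add_cancel, vtrans_zero] at h
    exact h
  have hHinj : Function.Injective H := by
    intro p q h
    have h1 := hHd p
    have h2 := hHd q
    rw [h] at h1
    have h3 := abs_le.1 ((abs_snd_sub_le_dist p q).trans (dist_triangle_left p q (H q)))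
    have hp := hbase p
    have hp' : p.2 - (⌈p.2⌉ : ℤ) ∈ Ioo (-(6 / 5)) (1 / 5 : ℝ) := by
      constructor <;> linarith [hp.1, hp.2]
    have hq' : q.2 - (⌈p.2⌉ : ℤ) ∈ Ioo (-(6 / 5)) (1 / 5 : ℝ) := by
      constructor <;> linarith [hp.1, hp.2]
    rw [hwin _ p hp', hwin _ q hq'] at h
    exact (vtrans X _).injective (hFinj hp' hq' ((vtrans X _).injective h))
  have hHloc : ∀ p, map H (𝓝 p) = 𝓝 (H p) := by
    intro p
    have hp := hbase p
    have hp' : p.2 - (⌈p.2⌉ : ℤ) ∈ Ioo (-(6 / 5)) (1 / 5 : ℝ) := by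
      constructor <;> linarith [hp.1, hp.2]
    have hev : H =ᶠ[𝓝 p] Fn ⌈p.2⌉ := by
      have hc : ContinuousAt (fun q : X × ℝ => q.2 - (⌈p.2⌉ : ℤ)) p := by fun_prop
      filter_upwards [hc.preimage_mem_nhds (isOpen_Ioo.mem_nhds hp')] with q hq
      exact hwin _ q hq
    have e1 : map (vtrans X (-(⌈p.2⌉ : ℤ))) (𝓝 p) = _ := (vtrans X _).map_nhds_eq p
    have e2 := hFloc (vtrans X (-(⌈p.2⌉ : ℤ)) p) hp'
    have e3 : map (vtrans X (⌈p.2⌉ : ℤ)) (𝓝 (F (vtrans X (-(⌈p.2⌉ : ℤ)) p))) = _ :=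
      (vtrans X _).map_nhds_eq _
    rw [Filter.map_congr hev]
    show _ = 𝓝 (vtrans X (⌈p.2⌉ : ℤ) (F (vtrans X (-(⌈p.2⌉ : ℤ)) p)))
    rw [← e3, ← e2, ← e1, Filter.map_map, Filter.map_map]
    rfl
  have hHsurj : Function.Surjective H := by
    have := subset_image_of_dist_le (f := H) (S := univ) (P := univ) (ε := 3 * ε) (ε' := 1)
      (by linarith) isPreconnected_univ (fun p _ => hHloc p) isOpen_univ (fun p _ => hHd p)
      (fun _ _ => subset_univ _) (by
        obtain ⟨x⟩ := ‹Nonempty X›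
        exact ⟨H (x, 0), mem_univ _, mem_image_of_mem _ (mem_univ _)⟩)
    intro y
    obtain ⟨p, -, hp⟩ := this (mem_univ y)
    exact ⟨p, hp⟩
  have hcont : Continuous H := continuous_iff_continuousAt.2 fun p => (hHloc p).le
  have hopen : IsOpenMap H := isOpenMap_iff_nhds_le.2 fun p => (hHloc p).ge
  refine ⟨(Equiv.ofBijective H ⟨hHinj, hHsurj⟩).toHomeomorphOfContinuousOpen hcont hopen,
    hHd, fun p hp => ?_, fun x hx t => ?_⟩
  · have hp' := abs_lt.1 hp
    show H p = f p
    rw [hwin 0 p (by simp only [Int.cast_zero, sub_zero]; constructor <;> linarith [hp'.1, hp'.2])]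
    simp only [Fn, Int.cast_zero, neg_zero, vtrans_zero]
    exact htop p hp'
  · show Fn ⌈t⌉ (x, t) = (x, t)
    have hp := hbase (x, t)
    simp only at hp
    simp only [Fn]
    rw [vtrans_apply _ (x, t), hFid x hx, vtrans_apply]
    · simp
    · constructor <;> linarith [hp.1, hp.2]

end Periodic

/-! ### Radial compression -/

section Compression

variable {E : Type*} [MetricSpace E] [Zero E]

/-- The distance to the origin, truncated below at `1`. -/
def rad (p : E) : ℝ := max (dist p 0) 1

lemma one_le_rad (p : E) : 1 ≤ rad p := le_max_right _ _

lemma continuous_rad : Continuous (rad : E → ℝ) := by unfold rad; fun_prop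

lemma rad_lt_two {q : E} (hq : dist q 0 < 2) : rad q < 2 := max_lt hq one_lt_two

variable [MulActionWithZero ℝ≥0 E]

/-- Radial homeomorphism of `E` onto the ball of radius `2`. -/
def squeeze (p : E) : E := Real.toNNReal ((2 * rad p - 1) / rad p ^ 2) • p

/-- Inverse of `squeeze`. -/
def unsqueeze (q : E) : E := Real.toNNReal (1 / (rad q * (2 - rad q))) • q

lemma squeeze_of_le {p : E} (hp : dist p 0 ≤ 1) : squeeze p = p := by
  have : rad p = 1 := max_eq_right hp
  simp [squeeze, this]; norm_num

lemma unsqueeze_of_le {p : E} (hp : dist p 0 ≤ 1) : unsqueeze p = p := by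
  have : rad p = 1 := max_eq_right hp
  simp [unsqueeze, this]; norm_num

variable [IsBoundedSMul ℝ≥0 E]

lemma dist_smul_zero_eq (s : ℝ≥0) (p : E) : dist (s • p) 0 = s * dist p 0 := by
  refine le_antisymm ?_ ?_
  · simpa using dist_smul_smul_le s p 0
  · by_cases h : s = 0
    · simp [h]
    · have h1 : dist p 0 ≤ (s⁻¹ : ℝ≥0) * dist (s • p) 0 := by
        simpa [inv_smul_smul₀ h] using dist_smul_smul_le s⁻¹ (s • p) 0
      have hs : (0 : ℝ) < s := by positivity
      rw [NNReal.coe_inv, inv_mul_eq_div, le_div_iff₀ hs] at h1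
      linarith

lemma continuous_squeeze : Continuous (squeeze : E → E) := by
  have : Continuous fun p : E => (2 * rad p - 1) / rad p ^ 2 := by
    refine Continuous.div ?_ ?_ fun p => ?_
    · exact (continuous_const.mul continuous_rad).sub continuous_const
    · exact continuous_rad.pow 2
    · have := one_le_rad p; positivity
  exact (continuous_real_toNNReal.comp this).smul continuous_id

lemma continuousOn_unsqueeze : ContinuousOn (unsqueeze : E → E) {q | dist q 0 < 2} := by
  have : ContinuousOn (fun q : E => 1 / (rad q * (2 - rad q))) {q | dist q 0 < 2} := by
    refine ContinuousOn.div continuousOn_const ?_ fun q hq => ?_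
    · exact (continuous_rad.mul (continuous_const.sub continuous_rad)).continuousOn
    · have h1 := one_le_rad q
      have h2 := rad_lt_two hq
      have : 0 < rad q * (2 - rad q) := mul_pos (by linarith) (by linarith)
      exact this.ne'
  exact (continuous_real_toNNReal.comp_continuousOn this).smul continuousOn_id

lemma dist_squeeze_zero {p : E} (hp : 1 ≤ dist p 0) :
    dist (squeeze p) 0 = 2 - 1 / dist p 0 := by
  have h : rad p = dist p 0 := max_eq_left hp
  rw [squeeze, dist_smul_zero_eq, h, Real.coe_toNNReal]
  · have : dist p 0 ≠ 0 := by positivity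
    field_simp
  · apply div_nonneg (by linarith) (by positivity)

lemma dist_unsqueeze_zero {q : E} (hq : 1 ≤ dist q 0) (hq' : dist q 0 < 2) :
    dist (unsqueeze q) 0 = 1 / (2 - dist q 0) := by
  have h : rad q = dist q 0 := max_eq_left hq
  have h2 : (0 : ℝ) < 2 - dist q 0 := by linarith
  rw [unsqueeze, dist_smul_zero_eq, h, Real.coe_toNNReal]
  · have : dist q 0 ≠ 0 := by positivity
    field_simp
  · positivity

lemma dist_squeeze_zero_lt (p : E) : dist (squeeze p) 0 < 2 := by
  rcases le_total (dist p 0) 1 with h | h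
  · rw [squeeze_of_le h]; linarith
  · rw [dist_squeeze_zero h]
    have : (0 : ℝ) < 1 / dist p 0 := by positivity
    linarith

lemma unsqueeze_squeeze (p : E) : unsqueeze (squeeze p) = p := by
  rcases le_total (dist p 0) 1 with h | h
  · rw [squeeze_of_le h, unsqueeze_of_le h]
  · have h1 := dist_squeeze_zero h
    have h0 : 0 < dist p 0 := by linarith
    have h2 : 1 ≤ dist (squeeze p) 0 := by
      rw [h1]
      have : 1 / dist p 0 ≤ 1 := by rw [div_le_one h0]; exact h
      linarith
    have h3 : rad (squeeze p) = 2 - 1 / dist p 0 := by rw [← h1]; exact max_eq_left h2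
    have h4 : rad p = dist p 0 := max_eq_left h
    have h5 : 0 < 2 * dist p 0 - 1 := by linarith
    rw [unsqueeze, h3, squeeze, h4, smul_smul, ← Real.toNNReal_mul]
    · rw [show 1 / ((2 - 1 / dist p 0) * (2 - (2 - 1 / dist p 0))) *
          ((2 * dist p 0 - 1) / dist p 0 ^ 2) = 1 by field_simp; ring_nf]
      simp
    · rw [h1] at h2
      have : 0 < 1 / dist p 0 := by positivity
      apply div_nonneg zero_le_one (mul_nonneg (by linarith) (by linarith))

lemma rad_unsqueeze {q : E} (hq : dist q 0 < 2) : rad (unsqueeze q) = 1 / (2 - rad q) := by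
  rcases le_total (dist q 0) 1 with h | h
  · have h4 : rad q = 1 := max_eq_right h
    rw [unsqueeze_of_le h, h4]; norm_num
  · have h4 : rad q = dist q 0 := max_eq_left h
    rw [h4, rad, dist_unsqueeze_zero h hq, max_eq_left]
    rw [le_div_iff₀ (by linarith)]; linarith

lemma squeeze_unsqueeze {q : E} (hq : dist q 0 < 2) : squeeze (unsqueeze q) = q := by
  have h1 := one_le_rad q
  have h2 := rad_lt_two hq
  have h3 : 0 < 2 - rad q := by linarith
  rw [squeeze, rad_unsqueeze hq, unsqueeze, smul_smul, ← Real.toNNReal_mul]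
  · rw [show (2 * (1 / (2 - rad q)) - 1) / (1 / (2 - rad q)) ^ 2 *
        (1 / (rad q * (2 - rad q))) = 1 by field_simp; ring]
    simp
  · apply div_nonneg _ (by positivity)
    rw [mul_one_div, sub_nonneg, le_div_iff₀ h3]
    linarith

lemma dist_squeeze_le (p q : E) : dist (squeeze p) (squeeze q) ≤ 6 * dist p q / rad p := by
  have hp := one_le_rad p
  have hq := one_le_rad q
  set m := rad p with hm
  set n := rad q with hn
  have hmn : |m - n| ≤ dist p q := by
    have h1 : |max (dist p 0) 1 - max (dist q 0) 1| ≤ |dist p 0 - dist q 0| := by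
      simpa using abs_max_sub_max_le_abs (dist p 0) (dist q 0) 1
    exact h1.trans (abs_dist_sub_le p q 0)
  have hpos : ∀ x : ℝ, 1 ≤ x → 0 ≤ (2 * x - 1) / x ^ 2 := fun x hx =>
    div_nonneg (by linarith) (by positivity)
  have h1 : dist (squeeze p) (Real.toNNReal ((2 * m - 1) / m ^ 2) • q) ≤ 2 * dist p q / m := by
    refine (dist_smul_smul_le _ _ _).trans ?_
    rw [Real.coe_toNNReal _ (hpos m hp), div_mul_eq_mul_div, div_le_div_iff₀ (by positivity)
      (by positivity)]
    have : 0 ≤ dist p q * m := by positivity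
    nlinarith
  have h2 : dist (Real.toNNReal ((2 * m - 1) / m ^ 2) • q) (squeeze q) ≤ 4 * dist p q / m := by
    refine (dist_pair_smul _ _ _).trans ?_
    rw [NNReal.dist_eq, Real.coe_toNNReal _ (hpos m hp), Real.coe_toNNReal _ (hpos n hq)]
    have hqn : dist q 0 ≤ n := le_max_left _ _
    have e : (2 * m - 1) / m ^ 2 - (2 * n - 1) / n ^ 2 =
        (m - n) * ((m + n) - 2 * m * n) / (m ^ 2 * n ^ 2) := by field_simp; ring
    have e2 : |(m + n) - 2 * m * n| ≤ 2 * (m * n) := by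
      rw [abs_le]; constructor <;> nlinarith
    have h3 : |(2 * m - 1) / m ^ 2 - (2 * n - 1) / n ^ 2| ≤ 2 * dist p q / (m * n) := by
      rw [e, abs_div, abs_mul, abs_of_pos (show 0 < m ^ 2 * n ^ 2 by positivity),
        div_le_div_iff₀ (by positivity) (by positivity)]
      calc |m - n| * |m + n - 2 * m * n| * (m * n)
          ≤ dist p q * (2 * (m * n)) * (m * n) := by gcongr
        _ = 2 * dist p q * (m ^ 2 * n ^ 2) := by ring
    calc _ ≤ 2 * dist p q / (m * n) * n := by gcongr
      _ = 2 * dist p q / m := by field_simp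
      _ ≤ _ := by gcongr; norm_num
  calc _ ≤ _ := dist_triangle _ _ _
    _ ≤ 2 * dist p q / m + 4 * dist p q / m := add_le_add h1 h2
    _ = _ := by ring

open Classical in
/-- Conjugate a self-map of `E` by the radial homeomorphism of `E` onto the ball of radius `2`,
extending by the identity. -/
def compress (φ : E → E) (q : E) : E :=
  if dist q 0 < 2 then squeeze (φ (unsqueeze q)) else q

lemma dist_compress_le {φ : E → E} {C : ℝ} (hC : 0 ≤ C) (hφ : ∀ p, dist (φ p) p ≤ C) (q : E) :
    dist (compress φ q) q ≤ 6 * C * max 0 (2 - rad q) := by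
  by_cases hq : dist q 0 < 2
  · rw [compress, if_pos hq]
    nth_rewrite 2 [← squeeze_unsqueeze hq]
    rw [dist_comm]
    refine (dist_squeeze_le _ _).trans ?_
    have h2 := rad_lt_two hq
    rw [rad_unsqueeze hq, max_eq_right (by linarith), div_div_eq_mul_div, div_one, dist_comm]
    have : (0 : ℝ) ≤ 2 - rad q := by linarith
    gcongr
    exact hφ _
  · rw [compress, if_neg hq, dist_self]; positivity

lemma continuous_compress {φ : E → E} {C : ℝ} (hc : Continuous φ) (hφ : ∀ p, dist (φ p) p ≤ C) :
    Continuous (compress φ) := by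
  rw [continuous_iff_continuousAt]
  intro q
  have hC : 0 ≤ C := dist_nonneg.trans (hφ q)
  by_cases hq : dist q 0 < 2
  · have ho : IsOpen {q : E | dist q 0 < 2} := isOpen_lt (by fun_prop) (by fun_prop)
    have h1 : ContinuousOn (fun q : E => squeeze (φ (unsqueeze q))) {q | dist q 0 < 2} :=
      continuous_squeeze.comp_continuousOn (hc.comp_continuousOn continuousOn_unsqueeze)
    refine (h1.congr fun q hq => ?_).continuousAt (ho.mem_nhds hq)
    exact if_pos hq
  · have h0 : compress φ q = q := by rw [compress, if_neg hq]
    rw [ContinuousAt, h0, tendsto_iff_dist_tendsto_zero]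
    have h1 : Tendsto (fun x : E => 6 * C * max 0 (2 - rad x)) (𝓝 q) (𝓝 0) := by
      have : Continuous fun x : E => 6 * C * max 0 (2 - rad x) :=
        continuous_const.mul (continuous_const.max (continuous_const.sub continuous_rad))
      have h2 := this.tendsto q
      have h3 : dist q 0 ≤ rad q := le_max_left _ _
      rwa [max_eq_left (by linarith),
        mul_zero] at h2
    have h3 : Tendsto (fun x : E => dist x q) (𝓝 q) (𝓝 0) := by
      have : Continuous fun x : E => dist x q := by fun_prop
      simpa using this.tendsto q
    exact squeeze_zero (fun _ => dist_nonneg)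
      (fun x => (dist_triangle _ x _).trans (add_le_add_left (dist_compress_le hC hφ x) _))
      (by simpa using h1.add h3)

lemma compress_compress {φ ψ : E → E} (h : ∀ p, φ (ψ p) = p) (q : E) :
    compress φ (compress ψ q) = q := by
  by_cases hq : dist q 0 < 2
  · have : compress ψ q = squeeze (ψ (unsqueeze q)) := by rw [compress, if_pos hq]
    rw [this, compress, if_pos (dist_squeeze_zero_lt _), unsqueeze_squeeze, h,
      squeeze_unsqueeze hq]
  · have : compress ψ q = q := by rw [compress, if_neg hq]
    rw [this, compress, if_neg hq]

lemma exists_compression (H : E ≃ₜ E) {C : ℝ} (hH : ∀ p, dist (H p) p ≤ C) :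
    ∃ g : E ≃ₜ E, (∀ p ∉ closedBall (0 : E) 2, g p = p) ∧ (∀ p, dist (g p) p ≤ 6 * C) ∧
      (∀ p, dist p 0 ≤ 1 → dist (H p) 0 ≤ 1 → g p = H p) ∧
      ∀ p, (∀ s : ℝ≥0, 1 ≤ s → H (s • p) = s • p) → g p = p := by
  have hH' : ∀ p, dist (H.symm p) p ≤ C := fun p => by
    have := hH (H.symm p)
    rwa [H.apply_symm_apply, dist_comm] at this
  refine ⟨{ toFun := compress H
            invFun := compress H.symm
            left_inv := compress_compress (by simp)
            right_inv := compress_compress (by simp)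
            continuous_toFun := continuous_compress H.continuous hH
            continuous_invFun := continuous_compress H.symm.continuous hH' }, ?_, ?_, ?_, ?_⟩
  · intro p hp
    rw [mem_closedBall, not_le] at hp
    show compress H p = p
    rw [compress, if_neg (by linarith)]
  · intro p
    have hC : 0 ≤ C := dist_nonneg.trans (hH p)
    refine (dist_compress_le hC hH p).trans ?_
    have := one_le_rad p
    have h2 : max 0 (2 - rad p) ≤ 1 := max_le zero_le_one (by linarith)
    nlinarith
  · intro p hp hp'
    show compress H p = H p
    rw [compress, if_pos (by linarith), unsqueeze_of_le hp, squeeze_of_le hp']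
  · intro p hp
    show compress H p = p
    by_cases hq : dist p 0 < 2
    · rw [compress, if_pos hq]
      nth_rewrite 2 [← squeeze_unsqueeze hq]
      congr 1
      apply hp
      have h1 := one_le_rad p
      have h2 := rad_lt_two hq
      rw [← Real.toNNReal_one]
      apply Real.toNNReal_le_toNNReal
      rw [le_div_iff₀ (mul_pos (by linarith) (by linarith))]
      nlinarith [sq_nonneg (rad p - 1)]
    · rw [compress, if_neg hq]

end Compression

section Handle

instance : IsBoundedSMul ℝ≥0 ℝ where
  dist_smul_pair' s x y := by
    simp only [NNReal.smul_def, NNReal.dist_eq, Real.dist_eq, smul_eq_mul, ← mul_sub, abs_mul]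
    simp
  dist_pair_smul' s t x := by
    simp only [NNReal.smul_def, NNReal.dist_eq, Real.dist_eq, smul_eq_mul, ← sub_mul, abs_mul]
    simp

instance : PreconnectedSpace ℝ≥0 :=
  ⟨by
    have h : Function.Surjective Real.toNNReal := fun x => ⟨x, Real.toNNReal_coe⟩
    rw [← h.range_eq, ← image_univ]
    exact isPreconnected_univ.image _ continuous_real_toNNReal.continuousOn⟩

variable {X : Type*} [MetricSpace X] [ProperSpace X] [Zero X] [MulActionWithZero ℝ≥0 X]
  [IsBoundedSMul ℝ≥0 X] [PreconnectedSpace X]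

/-- Local version of the handle straightening: an almost-identity embedding of a strip agrees
near the origin with a small compactly supported homeomorphism. -/
lemma exists_local_straightening {f : X × ℝ → X × ℝ} {ε : ℝ} (hε : ε ≤ 1 / 100)
    (hloc : ∀ p : X × ℝ, |p.2| < 2 → map f (𝓝 p) = 𝓝 (f p))
    (hinj : InjOn f {p | |p.2| < 2}) (hd : ∀ p : X × ℝ, |p.2| < 2 → dist (f p) p ≤ ε) :
    ∃ g : X × ℝ ≃ₜ X × ℝ, (∀ p ∉ closedBall (0 : X × ℝ) 2, g p = p) ∧
      (∀ p, dist (g p) p ≤ 18 * ε) ∧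
      (∀ p : X × ℝ, |p.2| < 1 / 5 → dist p 0 ≤ 1 → dist (f p) 0 ≤ 1 → g p = f p) ∧
      ∀ x : X, (∀ s : ℝ≥0, 1 ≤ s → ∀ t : ℝ, |t| < 2 → f (s • x, t) = (s • x, t)) →
        ∀ t, g (x, t) = (x, t) := by
  obtain ⟨H, hHd, hHf, hHid⟩ := exists_periodic_extension hε hloc hinj hd
  obtain ⟨g, h1, h2, h3, h4⟩ := exists_compression H hHd
  refine ⟨g, h1, fun p => (h2 p).trans (by linarith), fun p hp hp1 hp2 => ?_, fun x hx t => ?_⟩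
  · rw [← hHf p hp] at hp2 ⊢
    exact h3 p hp1 hp2
  · exact h4 _ fun s hs => hHid _ (hx s hs) _

end Handle

/-! ### Handle corrections in a metric surface -/

section Corrections

variable {E M : Type*} [MetricSpace E] [MetricSpace M]

lemma exists_pos_forall_dist_symm_lt (e : OpenPartialHomeomorph E M) {K : Set E}
    (hK : IsCompact K) (hKe : K ⊆ e.source) {η : ℝ} (hη : 0 < η) :
    ∃ δ > 0, ∀ p ∈ K, ∀ y, dist y (e p) < δ → y ∈ e.target ∧ dist (e.symm y) p < η := by
  have hK' : IsCompact (e '' K) := hK.image_of_continuousOn (e.continuousOn.mono hKe)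
  have hsub : e '' K ⊆ e.target := by
    rintro _ ⟨p, hp, rfl⟩
    exact e.map_source (hKe hp)
  obtain ⟨δ₁, h1, h1'⟩ := hK'.exists_thickening_subset_open e.open_target hsub
  have hu := hK'.uniformContinuousAt_of_continuousAt e.symm
    (fun a ha => e.continuousAt_symm (hsub ha)) (Metric.dist_mem_uniformity hη)
  obtain ⟨δ₂, h2, h2'⟩ := Metric.mem_uniformity_dist.1 hu
  refine ⟨min δ₁ δ₂, lt_min h1 h2, fun p hp y hy => ⟨?_, ?_⟩⟩
  · exact h1' (Metric.mem_thickening_iff.2 ⟨_, mem_image_of_mem e hp,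
      hy.trans_le (min_le_left _ _)⟩)
  · have h3 := h2' (a := e p) (b := y) (by rw [dist_comm]; exact hy.trans_le (min_le_right _ _))
      (mem_image_of_mem e hp)
    simp only [mem_ofPred_eq] at h3
    rwa [e.left_inv (hKe hp), dist_comm] at h3

lemma exists_pos_forall_dist_transport_lt (e : OpenPartialHomeomorph E M) {B : Set E}
    (hB : IsCompact B) (hBe : B ⊆ e.source) {ε : ℝ} (hε : 0 < ε) :
    ∃ η > 0, ∀ g : E ≃ₜ E, (∀ p ∉ B, g p = p) → (∀ p, dist (g p) p < η) →
      ∀ y, dist (transport e g y) y < ε := by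
  have hu := hB.uniformContinuousAt_of_continuousAt e
    (fun a ha => e.continuousAt (hBe ha)) (Metric.dist_mem_uniformity hε)
  obtain ⟨η, h, h'⟩ := Metric.mem_uniformity_dist.1 hu
  refine ⟨η, h, fun g hg hd y => ?_⟩
  by_cases hy : y ∈ e '' B
  · obtain ⟨p, hp, rfl⟩ := hy
    rw [transport_of_mem e g (hBe hp), dist_comm]
    exact h' (a := p) (b := g p) (by rw [dist_comm]; exact hd p) hp
  · rw [transport_of_notMem_image e hg hy, dist_self]
    exact hε

lemma map_chart_conj_nhds (e : OpenPartialHomeomorph E M) (h : M ≃ₜ M) {p : E}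
    (hp : p ∈ e.source) (hp' : h (e p) ∈ e.target) :
    map (fun q => e.symm (h (e q))) (𝓝 p) = 𝓝 (e.symm (h (e p))) := by
  rw [← e.symm.map_nhds_eq hp', ← h.map_nhds_eq, ← e.map_nhds_eq hp, Filter.map_map,
    Filter.map_map]
  rfl

variable {X : Type*} [MetricSpace X] [ProperSpace X] [Zero X]

lemma isCompact_box (a b : ℝ) : IsCompact {p : X × ℝ | dist p.1 0 ≤ a ∧ |p.2| ≤ b} := by
  have : {p : X × ℝ | dist p.1 0 ≤ a ∧ |p.2| ≤ b} = closedBall 0 a ×ˢ Icc (-b) b := by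
    ext p; simp [abs_le]
  rw [this]
  exact (isCompact_closedBall _ _).prod isCompact_Icc

variable [MulActionWithZero ℝ≥0 X] [IsBoundedSMul ℝ≥0 X]

lemma isotopicToId_of_fixed_off_image_box (e : OpenPartialHomeomorph (X × ℝ) M)
    {a b : ℝ} (ha : 0 < a) (hb : 0 < b)
    (hsrc : {p : X × ℝ | dist p.1 0 ≤ a ∧ |p.2| ≤ b} ⊆ e.source) (g : M ≃ₜ M)
    (hg : ∀ y ∉ e '' {p : X × ℝ | dist p.1 0 ≤ a ∧ |p.2| ≤ b}, g y = y) : IsotopicToId g := by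
  lift a to ℝ≥0 using ha.le
  have ha0 : a ≠ 0 := fun h => ha.ne' (congrArg _ h)
  let L : X × ℝ ≃ₜ X × ℝ :=
    (Homeomorph.smulOfNeZero (α := X) a ha0).prodCongr
      (Homeomorph.mulLeft₀ b hb.ne')
  have hL : L '' closedBall 0 1 = {p : X × ℝ | dist p.1 0 ≤ a ∧ |p.2| ≤ b} := by
    have key : ∀ p : X × ℝ, L p ∈ {p : X × ℝ | dist p.1 0 ≤ a ∧ |p.2| ≤ b} ↔
        p ∈ closedBall (0 : X × ℝ) 1 := by
      intro p
      have h1 : (L p).1 = a • p.1 := rfl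
      have h2 : (L p).2 = b * p.2 := rfl
      simp only [mem_ofPred_eq, h1, h2, dist_smul_zero_eq, abs_mul, abs_of_pos hb,
        mem_closedBall, Prod.dist_eq, max_le_iff, Prod.fst_zero, Prod.snd_zero, Real.dist_eq,
        sub_zero]
      constructor
      · rintro ⟨h, h'⟩
        exact ⟨by nlinarith, by nlinarith⟩
      · rintro ⟨h, h'⟩
        exact ⟨by nlinarith, by nlinarith⟩
    ext p
    constructor
    · rintro ⟨q, hq, rfl⟩
      exact (key q).2 hq
    · intro hp
      refine ⟨L.symm p, (key _).1 ?_, L.apply_symm_apply p⟩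
      rwa [L.apply_symm_apply]
  refine isotopicToId_of_fixed_off_image_closedBall (L.transOpenPartialHomeomorph e) (r := 1)
    ?_ g ?_
  · intro p hp
    have : L p ∈ e.source := hsrc (hL ▸ mem_image_of_mem L hp)
    simpa using this
  · intro y hy
    apply hg
    rw [← hL]
    rintro ⟨_, ⟨p, hp, rfl⟩, rfl⟩
    exact hy ⟨p, hp, rfl⟩

variable [PreconnectedSpace X]

/-- Straightening a homeomorphism near the core of a `1`-handle, relative to the attaching
region. -/
lemma exists_handle_correction {O : Set M} (e : OpenPartialHomeomorph (X × ℝ) M)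
    (hsrc : {p : X × ℝ | dist p.1 0 ≤ 1 ∧ |p.2| ≤ 2} ⊆ e.source)
    (hO : e '' {p : X × ℝ | dist p.1 0 ≤ 1 ∧ |p.2| ≤ 2} ⊆ O) {ε : ℝ} (hε : 0 < ε) :
    ∃ δ > 0, ∀ h : M ≃ₜ M, (∀ x ∈ O, dist (h x) x < δ) →
      (∀ p : X × ℝ, 1 / 2 ≤ dist p.1 0 → dist p.1 0 ≤ 1 → |p.2| ≤ 2 → h (e p) = e p) →
      ∃ g : M ≃ₜ M, IsotopicToId g ∧
        (∀ y ∉ e '' {p : X × ℝ | dist p.1 0 ≤ 1 / 2 ∧ |p.2| ≤ 2}, g y = y) ∧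
        (∀ y, dist (g y) y < ε) ∧
        ∀ p : X × ℝ, dist p.1 0 < 3 / 4 → |p.2| < 1 / 5 → g (h (e p)) = e p := by
  set K : Set (X × ℝ) := {p | dist p.1 0 ≤ 1 ∧ |p.2| ≤ 2} with hKdef
  set B : Set (X × ℝ) := {p | dist p.1 0 ≤ 1 / 2 ∧ |p.2| ≤ 2} with hBdef
  have hBK : B ⊆ K := fun p hp => ⟨by linarith [hp.1], hp.2⟩
  obtain ⟨η₁, hη₁, hη₁'⟩ := exists_pos_forall_dist_transport_lt e (isCompact_box (1 / 2) 2)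
    (hBK.trans hsrc) hε
  set η : ℝ := min (1 / 100) (η₁ / 19) with hηdef
  have hη : 0 < η := lt_min (by norm_num) (by positivity)
  obtain ⟨δ, hδ, hδ'⟩ := exists_pos_forall_dist_symm_lt e (isCompact_box 1 2) hsrc hη
  refine ⟨δ, hδ, fun h hh hfix => ?_⟩
  have hloc : ∀ p ∈ K, h (e p) ∈ e.target ∧ dist (e.symm (h (e p))) p < η := fun p hp =>
    hδ' p hp _ (hh _ (hO (mem_image_of_mem e hp)))
  classical
  let f : X × ℝ → X × ℝ := fun p => if dist p.1 0 < 1 then e.symm (h (e p)) else p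
  have f_in : ∀ p : X × ℝ, dist p.1 0 < 1 → f p = e.symm (h (e p)) := fun p hp => if_pos hp
  have f_id : ∀ p : X × ℝ, 1 / 2 ≤ dist p.1 0 → |p.2| ≤ 2 → f p = p := fun p hp hp2 => by
    by_cases h1 : dist p.1 0 < 1
    · rw [f_in p h1, hfix p hp h1.le hp2, e.left_inv (hsrc ⟨h1.le, hp2⟩)]
    · exact if_neg h1
  have fd : ∀ p : X × ℝ, |p.2| < 2 → dist (f p) p ≤ η := fun p hp => by
    by_cases h1 : dist p.1 0 < 1
    · rw [f_in p h1]; exact (hloc p ⟨h1.le, hp.le⟩).2.le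
    · rw [f_id p (by linarith) hp.le, dist_self]; exact hη.le
  have hη100 : η ≤ 1 / 100 := min_le_left _ _
  have fnear : ∀ p : X × ℝ, |p.2| < 2 → dist (f p).1 0 ≤ dist p.1 0 + 1 / 100 := fun p hp => by
    have h1 : dist (f p).1 p.1 ≤ dist (f p) p := le_max_left _ _
    have h2 := dist_triangle (f p).1 p.1 0
    linarith [fd p hp]
  obtain ⟨gE, g1, g2, g3, g4⟩ := exists_local_straightening (f := f) hη100
    (by
      intro p hp
      by_cases h1 : dist p.1 0 < 1
      · rw [f_in p h1, ← map_chart_conj_nhds e h (hsrc ⟨h1.le, hp.le⟩) (hloc p ⟨h1.le, hp.le⟩).1]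
        apply Filter.map_congr
        have : {q : X × ℝ | dist q.1 0 < 1} ∈ 𝓝 p :=
          (isOpen_lt (by fun_prop) (by fun_prop)).mem_nhds h1
        filter_upwards [this] with q hq using f_in q hq
      · rw [f_id p (by linarith) hp.le]
        conv_rhs => rw [← Filter.map_id (f := 𝓝 p)]
        apply Filter.map_congr
        have : {q : X × ℝ | 1 / 2 < dist q.1 0} ∈ 𝓝 p :=
          (isOpen_lt (by fun_prop) (by fun_prop)).mem_nhds (by
            show 1 / 2 < dist p.1 0
            linarith)
        have h2 : {q : X × ℝ | |q.2| < 2} ∈ 𝓝 p :=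
          (isOpen_lt (by fun_prop) (by fun_prop)).mem_nhds hp
        filter_upwards [this, h2] with q hq hq2 using f_id q (le_of_lt hq) (le_of_lt hq2))
    (by
      intro p hp q hq hpq
      have in_in : ∀ p q : X × ℝ, |p.2| < 2 → |q.2| < 2 → dist p.1 0 < 1 → dist q.1 0 < 1 →
          f p = f q → p = q := by
        intro p q hp hq h1 h2 hpq
        rw [f_in p h1, f_in q h2] at hpq
        have kp := hloc p ⟨h1.le, hp.le⟩
        have kq := hloc q ⟨h2.le, hq.le⟩
        exact e.injOn (hsrc ⟨h1.le, hp.le⟩) (hsrc ⟨h2.le, hq.le⟩)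
          (h.injective (e.symm.injOn kp.1 kq.1 hpq))
      have in_out : ∀ p q : X × ℝ, |p.2| < 2 → |q.2| < 2 → ¬ dist q.1 0 < 1 →
          f p = f q → p = q := by
        intro p q hp hq h2 hpq
        rw [f_id q (by linarith) hq.le] at hpq
        by_cases h3 : 1 / 2 ≤ dist p.1 0
        · rwa [f_id p h3 hp.le] at hpq
        · have := fnear p hp
          rw [hpq] at this
          linarith
      by_cases h1 : dist p.1 0 < 1
      · by_cases h2 : dist q.1 0 < 1
        · exact in_in p q hp hq h1 h2 hpq
        · exact in_out p q hp hq h2 hpq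
      · exact (in_out q p hq hp h1 hpq.symm).symm)
    fd
  have gB : ∀ p ∉ B, gE p = p := by
    intro p hp
    by_cases h1 : 1 / 2 ≤ dist p.1 0
    · refine g4 p.1 (fun s hs t ht => f_id _ ?_ ht.le) p.2
      simp only [dist_smul_zero_eq]
      have : (1 : ℝ) ≤ s := hs
      nlinarith
    · apply g1
      intro h2
      rw [mem_closedBall, Prod.dist_eq, max_le_iff] at h2
      refine hp ⟨by linarith, ?_⟩
      simpa using h2.2
  have gB' := symm_fixed_off gE gB
  refine ⟨transportHomeo e (isCompact_box (1 / 2) 2) (hBK.trans hsrc) gE.symm gB', ?_, ?_, ?_, ?_⟩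
  · exact isotopicToId_of_fixed_off_image_box e (by norm_num) (by norm_num) (hBK.trans hsrc) _
      fun y hy => transport_of_notMem_image e gB' hy
  · exact fun y hy => transport_of_notMem_image e gB' hy
  · refine hη₁' _ gB' fun p => ?_
    have := g2 (gE.symm p)
    rw [gE.apply_symm_apply, dist_comm] at this
    refine this.trans_lt ?_
    have : η ≤ η₁ / 19 := min_le_right _ _
    linarith
  · intro p hp1 hp2
    have hp2' : |p.2| < 2 := by linarith
    have hpK : p ∈ K := ⟨by linarith, hp2'.le⟩
    have h1 : gE p = f p := by
      have hfp := fd p hp2'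
      have h2 : |(f p).2 - p.2| ≤ dist (f p) p := abs_snd_sub_le_dist _ _
      have h3 := fnear p hp2'
      refine g3 p hp2 ?_ ?_
      · rw [Prod.dist_eq, max_le_iff]
        simp only [Prod.fst_zero, Prod.snd_zero, Real.dist_eq, sub_zero]
        constructor <;> linarith
      · rw [Prod.dist_eq, max_le_iff]
        simp only [Prod.fst_zero, Prod.snd_zero, Real.dist_eq, sub_zero]
        refine ⟨by linarith, ?_⟩
        have := abs_sub_abs_le_abs_sub (f p).2 p.2
        linarith
    rw [f_in p (by linarith)] at h1
    rw [transportHomeo_apply]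
    have h2 : h (e p) = e (gE p) := by rw [h1, e.right_inv (hloc p hpK).1]
    have h3 : gE p ∈ e.source := mapsTo_source e (hBK.trans hsrc) gE gB (hsrc hpK)
    rw [h2, transport_of_mem e _ h3, gE.symm_apply_apply]

end Corrections

/-! ### Correction near an interior point -/

section PointCorrection

lemma map_nhds_eq_of_lift {A B C : Type*} [TopologicalSpace A] [TopologicalSpace B]
    [TopologicalSpace C] {φ : B → C} {F : A → B} {G : A → C} {a : A} {S : Set B}
    (hφ : map φ (𝓝 (F a)) = 𝓝 (φ (F a))) (hS : S ∈ 𝓝 (F a)) (hinj : InjOn φ S)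
    (hF : ContinuousAt F a) (hG : map G (𝓝 a) = 𝓝 (G a)) (hGF : ∀ᶠ x in 𝓝 a, φ (F x) = G x) :
    map F (𝓝 a) = 𝓝 (F a) := by
  refine (map_eq_map_iff_of_injOn (hF hS) hS hinj).1 ?_
  rw [hφ, Filter.map_map, hGF.self_of_nhds, ← hG]
  exact Filter.map_congr hGF

lemma map_cexp_nhds (w : ℂ) : map Complex.exp (𝓝 w) = 𝓝 (Complex.exp w) :=
  (Complex.hasStrictDerivAt_exp w).map_nhds_eq (Complex.exp_ne_zero w)

lemma injOn_cexp_ball (w : ℂ) : InjOn Complex.exp (ball w Real.pi) := by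
  intro a ha b hb hab
  obtain ⟨n, hn⟩ := Complex.exp_eq_exp_iff_exists_int.1 hab
  have h1 : dist a b < 2 * Real.pi := by
    have := dist_triangle_right a b w
    rw [mem_ball] at ha hb
    linarith
  rw [hn, dist_eq_norm, add_sub_cancel_left] at h1
  simp only [norm_mul, Complex.norm_intCast, Complex.norm_ofNat, Complex.norm_real,
    Complex.norm_I, mul_one, Real.norm_eq_abs, abs_of_pos Real.pi_pos] at h1
  have h2 : |(n : ℝ)| < 1 := by nlinarith [Real.pi_pos]
  have h3 : n = 0 := by
    rw [← Int.cast_abs] at h2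
    exact Int.abs_lt_one_iff.1 (by exact_mod_cast h2)
  rw [hn, h3]; simp

/-- The coordinates `(x, t) ↦ t + i x` on the complex plane. -/
def stripCoord : ℝ × ℝ ≃ₜ ℂ :=
  (Homeomorph.prodComm ℝ ℝ).trans Complex.equivRealProdCLM.symm.toHomeomorph

lemma stripCoord_re (p : ℝ × ℝ) : (stripCoord p).re = p.2 := by
  rfl

lemma stripCoord_im (p : ℝ × ℝ) : (stripCoord p).im = p.1 := by
  rfl

lemma dist_stripCoord_symm_le (z w : ℂ) :
    dist (stripCoord.symm z) (stripCoord.symm w) ≤ ‖z - w‖ := by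
  have h1 : ∀ u : ℂ, (stripCoord.symm u).1 = u.im := fun u => by
    rw [← stripCoord_im, Homeomorph.apply_symm_apply]
  have h2 : ∀ u : ℂ, (stripCoord.symm u).2 = u.re := fun u => by
    rw [← stripCoord_re, Homeomorph.apply_symm_apply]
  rw [Prod.dist_eq, h1, h1, h2, h2, Real.dist_eq, Real.dist_eq, ← Complex.sub_im,
    ← Complex.sub_re]
  exact max_le (Complex.abs_im_le_norm _) (Complex.abs_re_le_norm _)

/-- An almost-identity embedding of an annulus lifts through the exponential to an
almost-identity embedding of a strip. -/
lemma exists_exp_lift {f : ℂ → ℂ} {η : ℝ} (hη : η ≤ 1 / 100)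
    (hloc : ∀ z ∈ closedBall (1 : ℂ) 9, map f (𝓝 z) = 𝓝 (f z))
    (hinj : InjOn f (closedBall (1 : ℂ) 9)) (hd : ∀ z ∈ closedBall (1 : ℂ) 9, ‖f z - z‖ ≤ η) :
    ∃ F : ℂ → ℂ, (∀ w : ℂ, |w.re| < 2 → Complex.exp w ∈ closedBall (1 : ℂ) 9) ∧
      (∀ w : ℂ, |w.re| < 2 → Complex.exp (F w) = f (Complex.exp w)) ∧
      (∀ w : ℂ, |w.re| < 2 → ‖F w - w‖ ≤ 12 * η) ∧
      (∀ w : ℂ, |w.re| < 2 → map F (𝓝 w) = 𝓝 (F w)) ∧ InjOn F {w | |w.re| < 2} := by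
  have he2 : Real.exp 2 < 8 := by
    have h1 := Real.exp_one_lt_d9
    rw [show (2 : ℝ) = 1 + 1 by norm_num, Real.exp_add]
    nlinarith [Real.exp_pos 1]
  have hnorm : ∀ w : ℂ, |w.re| < 2 → ‖Complex.exp w‖ < 8 ∧ 1 / 8 < ‖Complex.exp w‖ := by
    intro w hw
    rw [Complex.norm_exp]
    rw [abs_lt] at hw
    refine ⟨(Real.exp_lt_exp.2 hw.2).trans he2, ?_⟩
    refine lt_trans ?_ (Real.exp_lt_exp.2 hw.1)
    rw [Real.exp_neg, ← one_div]
    exact one_div_lt_one_div_of_lt (Real.exp_pos 2) he2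
  have hmem : ∀ w : ℂ, |w.re| < 2 → Complex.exp w ∈ closedBall (1 : ℂ) 9 := by
    intro w hw
    rw [mem_closedBall, dist_eq_norm]
    have := norm_sub_le (Complex.exp w) 1
    rw [norm_one] at this
    linarith [(hnorm w hw).1]
  let u : ℂ → ℂ := fun w => (f (Complex.exp w) - Complex.exp w) / Complex.exp w
  have hu : ∀ w : ℂ, |w.re| < 2 → ‖u w‖ ≤ 8 * η := by
    intro w hw
    have h1 := hnorm w hw
    rw [norm_div, div_le_iff₀ (by linarith)]
    have h2 := hd _ (hmem w hw)
    have : 0 ≤ η := (norm_nonneg _).trans h2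
    nlinarith
  have hexp : ∀ w : ℂ, |w.re| < 2 →
      Complex.exp (w + Complex.log (1 + u w)) = f (Complex.exp w) := by
    intro w hw
    have h0 : 1 + u w ≠ 0 := by
      refine Complex.slitPlane_ne_zero (Complex.mem_slitPlane_of_norm_lt_one ?_)
      exact (hu w hw).trans_lt (by linarith)
    have h1 := Complex.exp_ne_zero w
    rw [Complex.exp_add, Complex.exp_log h0]
    simp only [u]
    field_simp
    ring
  have hFd : ∀ w : ℂ, |w.re| < 2 → ‖w + Complex.log (1 + u w) - w‖ ≤ 12 * η := by
    intro w hw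
    rw [add_sub_cancel_left]
    have h1 := hu w hw
    have := Complex.norm_log_one_add_half_le_self (z := u w) (by linarith)
    linarith
  refine ⟨fun w => w + Complex.log (1 + u w), hmem, hexp, hFd, ?_, ?_⟩
  · intro w hw
    have hcf : ContinuousAt (fun w => f (Complex.exp w)) w := by
      have h1 : ContinuousAt f (Complex.exp w) := (hloc _ (hmem w hw)).le
      exact ContinuousAt.comp (f := Complex.exp) h1 Complex.continuous_exp.continuousAt
    have hcu : ContinuousAt u w := by
      refine ContinuousAt.div (hcf.sub Complex.continuous_exp.continuousAt)
        Complex.continuous_exp.continuousAt (Complex.exp_ne_zero w)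
    have hcF : ContinuousAt (fun w => w + Complex.log (1 + u w)) w := by
      refine continuousAt_id.add (ContinuousAt.clog (continuousAt_const.add hcu) ?_)
      exact Complex.mem_slitPlane_of_norm_lt_one ((hu w hw).trans_lt (by linarith))
    refine map_nhds_eq_of_lift (φ := Complex.exp) (G := fun w => f (Complex.exp w))
      (map_cexp_nhds _) (ball_mem_nhds _ Real.pi_pos) (injOn_cexp_ball _) hcF ?_ ?_
    · rw [← hloc _ (hmem w hw), ← map_cexp_nhds w, Filter.map_map]
      rfl
    · have : {w : ℂ | |w.re| < 2} ∈ 𝓝 w :=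
        (isOpen_lt (by fun_prop) (by fun_prop)).mem_nhds hw
      filter_upwards [this] with x hx using hexp x hx
  · intro a ha b hb hab
    have h1 : f (Complex.exp a) = f (Complex.exp b) := by
      rw [← hexp a ha, ← hexp b hb]
      exact congrArg Complex.exp hab
    have h2 := hinj (hmem a ha) (hmem b hb) h1
    have h3 : u a = u b := by simp only [u, h2]
    simp only [h3] at hab
    exact add_right_cancel hab

variable {M : Type*} [MetricSpace M]

/-- Straightening a homeomorphism near an interior point. -/
lemma exists_point_correction {O : Set M} (e₀ : OpenPartialHomeomorph ℂ M)
    (hsrc : closedBall (1 : ℂ) 9 ⊆ e₀.source) (hO : e₀ '' closedBall (1 : ℂ) 9 ⊆ O) :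
    ∃ U' : Set M, IsOpen U' ∧ e₀ 1 ∈ U' ∧ ∀ ε > 0,
    ∃ δ > 0, ∀ h : M ≃ₜ M, (∀ x ∈ O, dist (h x) x < δ) →
      ∃ g : M ≃ₜ M, IsotopicToId g ∧ (∀ y ∉ e₀ '' closedBall (1 : ℂ) 9, g y = y) ∧
        (∀ y, dist (g y) y < ε) ∧ ∀ y ∈ U', g (h y) = y := by
  let e : OpenPartialHomeomorph (ℝ × ℝ) M :=
    stripCoord.transOpenPartialHomeomorph (Complex.expOpenPartialHomeomorph.trans e₀)
  have he : ∀ p, e p = e₀ (Complex.exp (stripCoord p)) := fun p => rfl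
  have hball : ∀ p ∈ closedBall (0 : ℝ × ℝ) 2, |p.1| ≤ 2 ∧ |p.2| ≤ 2 := fun p hp => by
    rw [mem_closedBall, Prod.dist_eq, max_le_iff] at hp
    simpa using hp
  have hmem : ∀ w : ℂ, |w.re| ≤ 2 → Complex.exp w ∈ closedBall (1 : ℂ) 9 := by
    intro w hw
    have he2 : Real.exp 2 < 8 := by
      have h1 := Real.exp_one_lt_d9
      rw [show (2 : ℝ) = 1 + 1 by norm_num, Real.exp_add]
      nlinarith [Real.exp_pos 1]
    rw [mem_closedBall, dist_eq_norm]
    have := norm_sub_le (Complex.exp w) 1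
    rw [norm_one, Complex.norm_exp] at this
    linarith [Real.exp_le_exp.2 (abs_le.1 hw).2]
  have hes : closedBall (0 : ℝ × ℝ) 2 ⊆ e.source := by
    intro p hp
    obtain ⟨h1, h2⟩ := hball p hp
    have h3 : Complex.exp (stripCoord p) ∈ e₀.source :=
      hsrc (hmem _ (by rwa [stripCoord_re]))
    have h4 : stripCoord p ∈ Complex.expOpenPartialHomeomorph.source := by
      show (stripCoord p).im ∈ Ioo _ _
      rw [stripCoord_im]
      rw [abs_le] at h1
      have := Real.pi_gt_three
      constructor <;> linarith
    simp only [e, Homeomorph.transOpenPartialHomeomorph_source, mem_preimage,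
      OpenPartialHomeomorph.trans_source]
    exact ⟨h4, h3⟩
  have himg : e '' closedBall (0 : ℝ × ℝ) 2 ⊆ e₀ '' closedBall (1 : ℂ) 9 := by
    rintro _ ⟨p, hp, rfl⟩
    exact ⟨Complex.exp (stripCoord p), hmem _ (by rw [stripCoord_re]; exact (hball p hp).2), rfl⟩
  refine ⟨e '' ball 0 (1 / 5), e.isOpen_image_of_subset_source isOpen_ball
    ((ball_subset_closedBall.trans (closedBall_subset_closedBall (by norm_num))).trans hes),
    ⟨0, by simp, ?_⟩, fun ε hε => ?_⟩
  · rw [he]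
    have : stripCoord 0 = 0 := by apply Complex.ext <;> simp [stripCoord_re, stripCoord_im]
    rw [this, Complex.exp_zero]
  obtain ⟨η₁, hη₁, hη₁'⟩ := exists_pos_forall_dist_transport_lt e
    (isCompact_closedBall (0 : ℝ × ℝ) 2) hes hε
  set η : ℝ := min (1 / 1200) (η₁ / 240) with hηdef
  have hη : 0 < η := lt_min (by norm_num) (by positivity)
  have hη1 : η ≤ 1 / 1200 := min_le_left _ _
  have hη2 : η ≤ η₁ / 240 := min_le_right _ _
  obtain ⟨δ, hδ, hδ'⟩ := exists_pos_forall_dist_symm_lt e₀ (isCompact_closedBall (1 : ℂ) 9) hsrc hη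
  refine ⟨δ, hδ, fun h hh => ?_⟩
  have hloc : ∀ p ∈ closedBall (1 : ℂ) 9, h (e₀ p) ∈ e₀.target ∧
      dist (e₀.symm (h (e₀ p))) p < η := fun p hp =>
    hδ' p hp _ (hh _ (hO (mem_image_of_mem e₀ hp)))
  obtain ⟨F, hFm, hF1, hF2, hF3, hF4⟩ := exists_exp_lift (f := fun z => e₀.symm (h (e₀ z)))
    (η := η) (by linarith) (fun z hz => map_chart_conj_nhds e₀ h (hsrc hz) (hloc z hz).1)
    (fun a ha b hb hab => e₀.injOn (hsrc ha) (hsrc hb)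
      (h.injective (e₀.symm.injOn (hloc a ha).1 (hloc b hb).1 hab)))
    (fun z hz => by rw [← dist_eq_norm]; exact (hloc z hz).2.le)
  let f : ℝ × ℝ → ℝ × ℝ := fun p => stripCoord.symm (F (stripCoord p))
  have fd : ∀ p : ℝ × ℝ, |p.2| < 2 → dist (f p) p ≤ 12 * η := fun p hp => by
    have h1 := dist_stripCoord_symm_le (F (stripCoord p)) (stripCoord p)
    rw [stripCoord.symm_apply_apply] at h1
    exact h1.trans (hF2 _ (by rwa [stripCoord_re]))
  obtain ⟨gE, g1, g2, g3, -⟩ := exists_local_straightening (f := f) (ε := 12 * η) (by linarith)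
    (fun p hp => by
      have h1 := hF3 (stripCoord p) (by rwa [stripCoord_re])
      show _ = 𝓝 (stripCoord.symm (F (stripCoord p)))
      rw [← stripCoord.symm.map_nhds_eq, ← h1, ← stripCoord.map_nhds_eq, Filter.map_map,
        Filter.map_map]
      rfl)
    (fun p hp q hq hpq => stripCoord.injective (hF4
      (by show |(stripCoord p).re| < 2; rw [stripCoord_re]; exact hp)
      (by show |(stripCoord q).re| < 2; rw [stripCoord_re]; exact hq) (stripCoord.symm.injective hpq)))
    fd
  have gB' := symm_fixed_off gE g1
  refine ⟨transportHomeo e (isCompact_closedBall _ _) hes gE.symm gB', ?_, ?_, ?_, ?_⟩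
  · exact isotopicToId_of_fixed_off_image_closedBall e hes _
      fun y hy => transport_of_notMem_image e gB' hy
  · exact fun y hy => transport_of_notMem_image e gB' fun hy' => hy (himg hy')
  · refine hη₁' _ gB' fun p => ?_
    have := g2 (gE.symm p)
    rw [gE.apply_symm_apply, dist_comm] at this
    refine this.trans_lt ?_
    linarith
  · rintro _ ⟨p, hp, rfl⟩
    rw [mem_ball] at hp
    have hp2 : |p.2| < 1 / 5 := lt_of_le_of_lt
      (by simpa using abs_snd_sub_le_dist p 0) hp
    have hp2' : |p.2| < 2 := by linarith
    have hfp := fd p hp2'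
    have h1 : gE p = f p := by
      refine g3 p hp2 (by linarith) ?_
      have := dist_triangle (f p) p 0
      linarith
    have hs : |(stripCoord p).re| < 2 := by rwa [stripCoord_re]
    have hK := hFm (stripCoord p) hs
    have hpB : p ∈ closedBall (0 : ℝ × ℝ) 2 := by rw [mem_closedBall]; linarith
    have h2 : h (e p) = e (gE p) := by
      rw [h1, he, he, stripCoord.apply_symm_apply, hF1 _ hs, e₀.right_inv (hloc _ hK).1]
    have h3 : gE p ∈ e.source := mapsTo_source e hes gE g1 (hes hpB)
    rw [transportHomeo_apply, h2, transport_of_mem e _ h3, gE.symm_apply_apply]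

end PointCorrection

/-! ### Correcting homeomorphisms on larger and larger sets -/

section Reach

variable {M : Type*} [MetricSpace M]

/-- Homeomorphisms that fix `U` pointwise and are close to the identity on `O` can be corrected by
small isotopies supported in `O` so as to fix `V` pointwise. -/
def Correctable (O U V : Set M) : Prop :=
  ∀ ε > 0, ∃ δ > 0, ∀ h : M ≃ₜ M, (∀ x ∈ O, dist (h x) x < δ) → (∀ x ∈ U, h x = x) →
    ∃ g : M ≃ₜ M, IsotopicToId g ∧ (∀ x ∉ O, g x = x) ∧ (∀ x, dist (g x) x < ε) ∧
      ∀ x ∈ V, g (h x) = x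

lemma Correctable.of_subset {O U V : Set M} (h : V ⊆ U) : Correctable O U V := fun ε hε =>
  ⟨1, one_pos, fun _ _ hf => ⟨Homeomorph.refl M, IsotopicToId.refl, fun _ _ => rfl,
    fun x => by simpa using hε, fun x hx => hf x (h hx)⟩⟩

lemma Correctable.trans {O U V W : Set M} (hU : Correctable O U V) (hV : Correctable O V W) :
    Correctable O U W := by
  intro ε hε
  obtain ⟨δ₂, hδ₂, H₂⟩ := hV (ε / 2) (half_pos hε)
  obtain ⟨δ₁, hδ₁, H₁⟩ := hU (min (ε / 2) (δ₂ / 2)) (lt_min (half_pos hε) (half_pos hδ₂))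
  refine ⟨min δ₁ (δ₂ / 2), lt_min hδ₁ (half_pos hδ₂), fun h hh hf => ?_⟩
  obtain ⟨g₁, i₁, s₁, d₁, f₁⟩ := H₁ h (fun x hx => (hh x hx).trans_le (min_le_left _ _)) hf
  obtain ⟨g₂, i₂, s₂, d₂, f₂⟩ := H₂ (h.trans g₁) (fun x hx => by
    have h1 := (hh x hx).trans_le (min_le_right _ _)
    have h2 := (d₁ (h x)).trans_le (min_le_right _ _)
    have := dist_triangle (g₁ (h x)) (h x) x
    show dist (g₁ (h x)) x < δ₂
    linarith) f₁
  refine ⟨g₁.trans g₂, i₁.trans i₂, fun x hx => ?_, fun x => ?_, f₂⟩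
  · show g₂ (g₁ x) = x
    rw [s₁ x hx, s₂ x hx]
  · have h1 := (d₁ x).trans_le (min_le_left _ _)
    have h2 := d₂ (g₁ x)
    have := dist_triangle (g₂ (g₁ x)) (g₁ x) x
    show dist (g₂ (g₁ x)) x < ε
    linarith

lemma Correctable.mono {O U V V' : Set M} (h : Correctable O U V) (hV : V' ⊆ V) :
    Correctable O U V' :=
  h.trans (.of_subset hV)

/-- A correction supported in a set `S` preserves the good behaviour outside of `S`. -/
lemma Correctable.of_local {O U S C : Set M} (hS : S ⊆ O)
    (h : ∀ ε > 0, ∃ δ > 0, ∀ h : M ≃ₜ M, (∀ x ∈ O, dist (h x) x < δ) → (∀ x ∈ U, h x = x) →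
      ∃ g : M ≃ₜ M, IsotopicToId g ∧ (∀ x ∉ S, g x = x) ∧ (∀ x, dist (g x) x < ε) ∧
        ∀ x ∈ C, g (h x) = x) : Correctable O U (U \ S ∪ C) := by
  intro ε hε
  obtain ⟨δ, hδ, H⟩ := h ε hε
  refine ⟨δ, hδ, fun h hh hf => ?_⟩
  obtain ⟨g, i, s, d, f⟩ := H h hh hf
  refine ⟨g, i, fun x hx => s x fun hx' => hx (hS hx'), d, ?_⟩
  rintro x (⟨hx, hxS⟩ | hx)
  · rw [hf x hx, s x hxS]
  · exact f x hx

/-- Homeomorphisms close to the identity and fixing `U` can be corrected near `A`. -/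
def Reach (O U A : Set M) : Prop := ∃ V, IsOpen V ∧ A ⊆ V ∧ Correctable O U V

/-- The set `D` can be added to any closed set near which a homeomorphism is fixed. -/
def Good (O D : Set M) : Prop :=
  ∀ A U : Set M, IsClosed A → IsOpen U → A ⊆ U → Reach O U (A ∪ closure D)

lemma Reach.of_subset {O U A : Set M} (hU : IsOpen U) (h : A ⊆ U) : Reach O U A :=
  ⟨U, hU, h, .of_subset subset_rfl⟩

lemma Reach.mono {O U A B : Set M} (h : Reach O U A) (hB : B ⊆ A) : Reach O U B :=
  let ⟨V, h1, h2, h3⟩ := h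
  ⟨V, h1, hB.trans h2, h3⟩

lemma Reach.trans {O U A B : Set M} (h : Reach O U A)
    (hB : ∀ V, IsOpen V → A ⊆ V → Reach O V B) : Reach O U B := by
  obtain ⟨V, h1, h2, h3⟩ := h
  obtain ⟨W, h4, h5, h6⟩ := hB V h1 h2
  exact ⟨W, h4, h5, h3.trans h6⟩

lemma Reach.union {O U A D : Set M} (h : Reach O U A) (hA : IsClosed A) (hD : Good O D) :
    Reach O U (A ∪ closure D) :=
  h.trans fun V hV hAV => hD A V hA hV hAV

lemma Good.mono {O D D' : Set M} (h : Good O D) (hD : D' ⊆ D) : Good O D' :=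
  fun A U hA hU hAU => (h A U hA hU hAU).mono (union_subset_union_right _ (closure_mono hD))

lemma Good.empty {O : Set M} : Good O ∅ := fun A U _ hU hAU =>
  Reach.of_subset hU (by simpa using hAU)

lemma Good.union {O D D' : Set M} (h : Good O D) (h' : Good O D') : Good O (D ∪ D') := by
  intro A U hA hU hAU
  rw [closure_union, ← union_assoc]
  exact (h A U hA hU hAU).union (hA.union isClosed_closure) h'

lemma good_of_isCompact {O D : Set M} (hD : IsCompact D)
    (h : ∀ x ∈ D, ∃ N ∈ 𝓝 x, Good O N) : Good O D :=
  hD.induction_on .empty (fun _ _ hst ht => ht.mono hst) (fun _ _ hs ht => hs.union ht)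
    fun x hx =>
      let ⟨N, hN, hG⟩ := h x hx
      ⟨N, mem_nhdsWithin_of_mem_nhds hN, hG⟩

/-! ### Points -/

lemma good_singleton_interior {O : Set M} (hO : IsOpen O) (e : OpenPartialHomeomorph (ℝ × ℝ) M)
    {p : ℝ × ℝ} (hp : p ∈ e.source) (hpO : e p ∈ O) : Good O {e p} := by
  intro A U hA hU hAU
  rw [closure_singleton]
  by_cases hx : e p ∈ A
  · exact Reach.of_subset hU (union_subset hAU (singleton_subset_iff.2 (hAU hx)))
  let c : OpenPartialHomeomorph ℂ M := stripCoord.symm.transOpenPartialHomeomorph e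
  have hc : ∀ z, c z = e (stripCoord.symm z) := fun z => rfl
  have hcs : stripCoord p ∈ c.source := by
    show stripCoord.symm (stripCoord p) ∈ e.source
    rwa [stripCoord.symm_apply_apply]
  have hN : c.source ∩ c ⁻¹' (O ∩ Aᶜ) ∈ 𝓝 (stripCoord p) := by
    refine (c.isOpen_inter_preimage (hO.inter hA.isOpen_compl)).mem_nhds ⟨hcs, ?_⟩
    show c (stripCoord p) ∈ O ∩ Aᶜ
    rw [hc, stripCoord.symm_apply_apply]
    exact ⟨hpO, hx⟩
  obtain ⟨r, hr, hrN⟩ := nhds_basis_closedBall.mem_iff.1 hN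
  have hr9 : ((r / 9 : ℝ) : ℂ) ≠ 0 := by exact_mod_cast (by positivity : r / 9 ≠ 0)
  let a : ℂ ≃ₜ ℂ := ((Homeomorph.addRight (-1 : ℂ)).trans (Homeomorph.mulLeft₀ _ hr9)).trans
    (Homeomorph.addRight (stripCoord p))
  have ha : ∀ z, a z = ((r / 9 : ℝ) : ℂ) * (z + -1) + stripCoord p := fun z => rfl
  have hab : ∀ z ∈ closedBall (1 : ℂ) 9, a z ∈ closedBall (stripCoord p) r := by
    intro z hz
    rw [mem_closedBall, dist_eq_norm] at hz ⊢
    rw [ha, add_sub_cancel_right, norm_mul, Complex.norm_real, Real.norm_eq_abs,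
      abs_of_pos (by positivity), ← sub_eq_add_neg]
    nlinarith
  let e₀ : OpenPartialHomeomorph ℂ M := a.transOpenPartialHomeomorph c
  have he₀ : ∀ z ∈ closedBall (1 : ℂ) 9, z ∈ e₀.source ∧ e₀ z ∈ O ∩ Aᶜ := fun z hz =>
    hrN (hab z hz)
  have hS : e₀ '' closedBall (1 : ℂ) 9 ⊆ O ∩ Aᶜ := by
    rintro _ ⟨z, hz, rfl⟩
    exact (he₀ z hz).2
  have hSc : IsClosed (e₀ '' closedBall (1 : ℂ) 9) :=
    ((isCompact_closedBall _ _).image_of_continuousOn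
      (e₀.continuousOn.mono fun z hz => (he₀ z hz).1)).isClosed
  obtain ⟨C, hC, h1C, H⟩ := exists_point_correction e₀ (fun z hz => (he₀ z hz).1)
    (hS.trans inter_subset_left)
  refine ⟨_, (hU.sdiff hSc).union hC, union_subset ?_ ?_,
    Correctable.of_local (hS.trans inter_subset_left) fun ε hε => ?_⟩
  · exact fun x hx => Or.inl ⟨hAU hx, fun hx' => (hS hx').2 hx⟩
  · rw [singleton_subset_iff]
    right
    convert h1C using 1
    show e p = e (stripCoord.symm (a 1))
    rw [ha]
    simp
  · obtain ⟨δ, hδ, H'⟩ := H ε hε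
    exact ⟨δ, hδ, fun h hh _ => H' h hh⟩

end Reach

/-! ### Radial reparametrization -/

section Radial

variable {X : Type*} [MetricSpace X] [Zero X] [MulActionWithZero ℝ≥0 X] [IsBoundedSMul ℝ≥0 X]

/-- The radial map which is linear on the radii in `[0, a]`, taken to `[0, b]`, and has slope `c`
on the radii beyond `a`. -/
def radial (a b c : ℝ) (x : X) : X :=
  Real.toNNReal ((b + c * (max (dist x 0) a - a)) / max (dist x 0) a) • x

lemma continuous_radial {a : ℝ} (b c : ℝ) (ha : 0 < a) : Continuous (radial a b c : X → X) := by
  unfold radial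
  refine Continuous.smul (continuous_real_toNNReal.comp (Continuous.div ?_ ?_ ?_)) continuous_id
  · fun_prop
  · fun_prop
  · exact fun x => (ha.trans_le (le_max_right _ _)).ne'

lemma dist_radial_of_le {a b c : ℝ} (ha : 0 < a) (hb : 0 < b) {x : X} (hx : dist x 0 ≤ a) :
    dist (radial a b c x) 0 = b / a * dist x 0 := by
  rw [radial, max_eq_right hx, dist_smul_zero_eq]
  simp [Real.coe_toNNReal _ (div_pos hb ha).le]

lemma dist_radial_of_ge {a b c : ℝ} (ha : 0 < a) (hb : 0 < b) (hc : 0 < c) {x : X}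
    (hx : a ≤ dist x 0) : dist (radial a b c x) 0 = b + c * (dist x 0 - a) := by
  have : 0 ≤ c * (dist x 0 - a) := mul_nonneg hc.le (by linarith)
  have h0 : 0 < dist x 0 := ha.trans_le hx
  rw [radial, max_eq_left hx, dist_smul_zero_eq, Real.coe_toNNReal _ (by positivity)]
  field_simp

lemma radial_radial {a b c : ℝ} (ha : 0 < a) (hb : 0 < b) (hc : 0 < c) (x : X) :
    radial b a c⁻¹ (radial a b c x) = x := by
  have key : ∀ s t : ℝ, 0 < s → t * s = 1 → Real.toNNReal t • Real.toNNReal s • x = x := by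
    intro s t hs hts
    have ht : 0 ≤ t := by nlinarith
    rw [smul_smul, ← Real.toNNReal_mul ht, hts, Real.toNNReal_one, one_smul]
  rcases le_total (dist x 0) a with hx | hx
  · have h1 : dist (radial a b c x) 0 ≤ b := by
      rw [dist_radial_of_le ha hb hx, div_mul_eq_mul_div, div_le_iff₀ ha]
      exact mul_le_mul_of_nonneg_left hx hb.le
    unfold radial at h1 ⊢
    rw [max_eq_right h1, max_eq_right hx]
    refine key _ _ ?_ ?_
    · simpa using div_pos hb ha
    · field_simp
      simp
  · have h0 : 0 < dist x 0 := ha.trans_le hx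
    have h3 : 0 ≤ c * (dist x 0 - a) := mul_nonneg hc.le (by linarith)
    have h2 := dist_radial_of_ge ha hb hc hx
    have h1 : b ≤ dist (radial a b c x) 0 := by rw [h2]; linarith
    rw [radial, max_eq_left h1, h2, radial, max_eq_left hx]
    refine key _ _ ?_ ?_
    · positivity
    · field_simp
      ring

/-- `radial` as a homeomorphism. -/
def radialHomeo {a b c : ℝ} (ha : 0 < a) (hb : 0 < b) (hc : 0 < c) : X ≃ₜ X where
  toFun := radial a b c
  invFun := radial b a c⁻¹
  left_inv := radial_radial ha hb hc
  right_inv x := by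
    have := radial_radial hb ha (inv_pos.2 hc) x
    rwa [inv_inv] at this
  continuous_toFun := continuous_radial _ _ ha
  continuous_invFun := continuous_radial _ _ hb

end Radial

/-! ### Handles -/

section Handles

variable {M : Type*} [MetricSpace M]

lemma exists_thin_strip {X : Type*} [TopologicalSpace X] {K : Set X} (hK : IsCompact K)
    {N : Set (X × ℝ)} (hN : IsOpen N) (h : ∀ x ∈ K, (x, (0 : ℝ)) ∈ N) :
    ∃ s > 0, ∀ x ∈ K, ∀ t : ℝ, |t| ≤ s → (x, t) ∈ N := by
  obtain ⟨u, v, -, hv, hKu, h0v, huv⟩ := generalized_tube_lemma hK (isCompact_singleton (x := (0 : ℝ)))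
    hN (by rintro ⟨x, t⟩ ⟨hx, ht⟩; rw [mem_singleton_iff] at ht; subst ht; exact h x hx)
  obtain ⟨s, hs, hsv⟩ := nhds_basis_closedBall.mem_iff.1 (hv.mem_nhds (singleton_subset_iff.1 h0v))
  exact ⟨s, hs, fun x hx t ht => huv ⟨hKu hx, hsv (by simpa using ht)⟩⟩

lemma reach_handle {X : Type*} [MetricSpace X] [ProperSpace X] [Zero X] [MulActionWithZero ℝ≥0 X]
    [IsBoundedSMul ℝ≥0 X] [PreconnectedSpace X] {O A U : Set M} (hO : IsOpen O) (hA : IsClosed A)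
    (hU : IsOpen U) (hAU : A ⊆ U) (e : OpenPartialHomeomorph (X × ℝ) M) {L L' : ℝ} (hL : 0 < L)
    (hLL' : L < L') (hsrc : ∀ x : X, dist x 0 ≤ L' → (x, (0 : ℝ)) ∈ e.source)
    (heO : ∀ x : X, dist x 0 ≤ L' → e (x, 0) ∈ O)
    (heU : ∀ x : X, L ≤ dist x 0 → dist x 0 ≤ L' → e (x, 0) ∈ U)
    (heA : ∀ x : X, dist x 0 ≤ L → e (x, 0) ∉ A) :
    Reach O U (A ∪ (fun x : X => e (x, 0)) '' {x | dist x 0 < (L + L') / 2}) := by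
  obtain ⟨s₁, hs₁, H₁⟩ := exists_thin_strip (isCompact_closedBall (0 : X) L')
    (e.isOpen_inter_preimage hO) fun x hx => ⟨hsrc x hx, heO x hx⟩
  obtain ⟨s₂, hs₂, H₂⟩ := exists_thin_strip ((isCompact_closedBall (0 : X) L').inter_right
    (isClosed_le continuous_const (continuous_id.dist continuous_const) :
      IsClosed {x : X | L ≤ dist x 0}))
    (e.isOpen_inter_preimage hU) fun x hx => ⟨hsrc x hx.1, heU x hx.2 hx.1⟩
  obtain ⟨s₃, hs₃, H₃⟩ := exists_thin_strip (isCompact_closedBall (0 : X) L)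
    (e.isOpen_inter_preimage hA.isOpen_compl)
    fun x hx => ⟨hsrc x (le_trans hx hLL'.le), heA x hx⟩
  set s := min s₁ (min s₂ s₃) with hs_def
  have hs : 0 < s := lt_min hs₁ (lt_min hs₂ hs₃)
  have hs1 : s ≤ s₁ := min_le_left _ _
  have hs2 : s ≤ s₂ := (min_le_right _ _).trans (min_le_left _ _)
  have hs3 : s ≤ s₃ := (min_le_right _ _).trans (min_le_right _ _)
  have hhalf : (0 : ℝ) < 1 / 2 := by norm_num
  have hslope : 0 < 2 * (L' - L) := by linarith
  let R : X ≃ₜ X := radialHomeo hhalf hL hslope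
  have R1 : ∀ x, dist x 0 ≤ 1 / 2 → dist (R x) 0 ≤ L := fun x hx => by
    refine (dist_radial_of_le hhalf hL hx).trans_le ?_
    rw [div_mul_eq_mul_div, div_le_iff₀ hhalf]
    exact mul_le_mul_of_nonneg_left hx hL.le
  have R2 : ∀ x, 1 / 2 ≤ dist x 0 → dist (R x) 0 = L + 2 * (L' - L) * (dist x 0 - 1 / 2) :=
    fun x hx => dist_radial_of_ge hhalf hL hslope hx
  have R3 : ∀ x, dist x 0 ≤ 1 → dist (R x) 0 ≤ L' := fun x hx => by
    rcases le_total (dist x 0) (1 / 2) with h | h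
    · exact (R1 x h).trans hLL'.le
    · rw [R2 x h]; nlinarith
  have R4 : ∀ x, dist x 0 < (L + L') / 2 → dist (R.symm x) 0 < 3 / 4 := fun x hx => by
    rcases le_total (dist x 0) L with h | h
    · refine (dist_radial_of_le hL hhalf h).trans_lt ?_
      rw [div_mul_eq_mul_div, div_lt_iff₀ hL]
      nlinarith
    · refine (dist_radial_of_ge hL hhalf (inv_pos.2 hslope) h).trans_lt ?_
      have : (2 * (L' - L))⁻¹ * (dist x 0 - L) < 1 / 4 := by
        rw [inv_mul_lt_iff₀ hslope]; linarith
      linarith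
  have hs' : s / 2 ≠ 0 := by positivity
  let c : OpenPartialHomeomorph (X × ℝ) M :=
    (R.prodCongr (Homeomorph.mulLeft₀ _ hs')).transOpenPartialHomeomorph e
  have hc : ∀ p, c p = e (R p.1, s / 2 * p.2) := fun p => rfl
  have hcs : ∀ p, p ∈ c.source ↔ (R p.1, s / 2 * p.2) ∈ e.source := fun p => Iff.rfl
  have ht : ∀ t : ℝ, |t| ≤ 2 → |s / 2 * t| ≤ s := fun t ht => by
    rw [abs_mul, abs_of_pos (by positivity)]
    nlinarith
  have hbox : {p : X × ℝ | dist p.1 0 ≤ 1 ∧ |p.2| ≤ 2} ⊆ c.source := fun p hp =>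
    (hcs p).2 (H₁ _ (R3 _ hp.1) _ ((ht _ hp.2).trans hs1)).1
  have hboxO : c '' {p : X × ℝ | dist p.1 0 ≤ 1 ∧ |p.2| ≤ 2} ⊆ O := by
    rintro _ ⟨p, hp, rfl⟩
    exact (H₁ _ (R3 _ hp.1) _ ((ht _ hp.2).trans hs1)).2
  set S := c '' {p : X × ℝ | dist p.1 0 ≤ 1 / 2 ∧ |p.2| ≤ 2} with hSdef
  have hbox' : {p : X × ℝ | dist p.1 0 ≤ 1 / 2 ∧ |p.2| ≤ 2} ⊆
      {p : X × ℝ | dist p.1 0 ≤ 1 ∧ |p.2| ≤ 2} := fun p hp => ⟨hp.1.trans (by norm_num), hp.2⟩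
  have hSc : IsClosed S := ((isCompact_box (X := X) (1 / 2) 2).image_of_continuousOn
    (c.continuousOn.mono (hbox'.trans hbox))).isClosed
  have hSO : S ⊆ O := (image_mono hbox').trans hboxO
  have hSA : ∀ x ∈ A, x ∉ S := by
    rintro _ hx ⟨p, hp, rfl⟩
    exact (H₃ _ (R1 _ hp.1) _ ((ht _ hp.2).trans hs3)).2 hx
  have hCo : IsOpen {p : X × ℝ | dist p.1 0 < 3 / 4 ∧ |p.2| < 1 / 5} :=
    IsOpen.and (isOpen_lt (f := fun p : X × ℝ => dist p.1 0) (by fun_prop) (by fun_prop))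
      (isOpen_lt (f := fun p : X × ℝ => |p.2|) (by fun_prop) (by fun_prop))
  refine ⟨U \ S ∪ c '' {p : X × ℝ | dist p.1 0 < 3 / 4 ∧ |p.2| < 1 / 5},
    (hU.sdiff hSc).union (c.isOpen_image_of_subset_source hCo fun p hp =>
      hbox ⟨by linarith [hp.1], by linarith [hp.2]⟩), union_subset ?_ ?_,
    Correctable.of_local hSO fun ε hε => ?_⟩
  · exact fun x hx => Or.inl ⟨hAU hx, hSA x hx⟩
  · rintro _ ⟨x, hx, rfl⟩
    refine Or.inr ⟨(R.symm x, 0), ⟨R4 x hx, by simp⟩, ?_⟩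
    rw [hc]
    simp
  · obtain ⟨δ, hδ, H⟩ := exists_handle_correction c hbox hboxO hε
    refine ⟨δ, hδ, fun h hh hf => ?_⟩
    have hatt : ∀ p : X × ℝ, 1 / 2 ≤ dist p.1 0 → dist p.1 0 ≤ 1 → |p.2| ≤ 2 → c p ∈ U := by
      intro p hp hp' hp2
      refine (H₂ _ ⟨R3 _ hp', ?_⟩ _ ((ht _ hp2).trans hs2)).2
      show L ≤ dist (R p.1) 0
      rw [R2 _ hp]
      have := mul_nonneg hslope.le (sub_nonneg.2 hp)
      linarith
    obtain ⟨g, g1, g2, g3, g4⟩ := H h hh fun p hp hp' hp2 => hf _ (hatt p hp hp' hp2)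
    refine ⟨g, g1, g2, g3, ?_⟩
    rintro _ ⟨p, hp, rfl⟩
    exact g4 p hp.1 hp.2

end Handles

/-! ### Segments -/

section Segments

variable {M : Type*} [MetricSpace M] {O : Set M}

lemma exists_pos_ball_mem {U : Set M} (hU : IsOpen U) (e : OpenPartialHomeomorph (ℝ × ℝ) M)
    {t : ℝ} (ht : (t, (0 : ℝ)) ∈ e.source) (htU : e (t, 0) ∈ U) :
    ∃ η > 0, ∀ s, |s - t| ≤ η → e (s, 0) ∈ U := by
  have h1 : ContinuousAt (fun s : ℝ => e (s, 0)) t :=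
    ContinuousAt.comp (f := fun s : ℝ => (s, (0 : ℝ))) (e.continuousAt ht)
      (by fun_prop)
  obtain ⟨η, hη, h⟩ := nhds_basis_closedBall.mem_iff.1 (h1 (hU.mem_nhds htU))
  exact ⟨η, hη, fun s hs => h (by rwa [mem_closedBall, Real.dist_eq])⟩

lemma reach_open_segment {A U : Set M} (hO : IsOpen O) (hA : IsClosed A) (hU : IsOpen U)
    (hAU : A ⊆ U) (e : OpenPartialHomeomorph (ℝ × ℝ) M) {c d : ℝ} (hcd : c < d)
    (hsrc : ∀ t ∈ Icc c d, (t, (0 : ℝ)) ∈ e.source) (heO : ∀ t ∈ Icc c d, e (t, 0) ∈ O)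
    (hc : e (c, 0) ∈ U) (hd : e (d, 0) ∈ U) (heA : ∀ t ∈ Ioo c d, e (t, 0) ∉ A) :
    Reach O U (A ∪ (fun t : ℝ => e (t, 0)) '' Icc c d) := by
  obtain ⟨η₁, hη₁, H₁⟩ := exists_pos_ball_mem hU e (hsrc c ⟨le_rfl, hcd.le⟩) hc
  obtain ⟨η₂, hη₂, H₂⟩ := exists_pos_ball_mem hU e (hsrc d ⟨hcd.le, le_rfl⟩) hd
  obtain ⟨η, hη, hηlt⟩ : ∃ η, 0 < η ∧ η < min (min η₁ η₂) ((d - c) / 2) :=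
    exists_between (lt_min (lt_min hη₁ hη₂) (by linarith))
  rw [lt_min_iff, lt_min_iff] at hηlt
  obtain ⟨⟨hη1, hη2⟩, hη3⟩ := hηlt
  have hcont : ContinuousOn (fun t : ℝ => e (t, 0)) (Icc c d) :=
    e.continuousOn.comp (by fun_prop) hsrc
  set B := (fun t : ℝ => e (t, 0)) '' (Icc c (c + η / 2) ∪ Icc (d - η / 2) d) with hB
  have hBcd : Icc c (c + η / 2) ∪ Icc (d - η / 2) d ⊆ Icc c d :=
    union_subset (Icc_subset_Icc le_rfl (by linarith)) (Icc_subset_Icc (by linarith) le_rfl)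
  have hBc : IsClosed B := ((isCompact_Icc.union isCompact_Icc).image_of_continuousOn
    (hcont.mono hBcd)).isClosed
  have hBU : B ⊆ U := by
    rintro _ ⟨t, ht | ht, rfl⟩
    · exact H₁ t (abs_le.2 ⟨by linarith [ht.1], by linarith [ht.2]⟩)
    · exact H₂ t (abs_le.2 ⟨by linarith [ht.1], by linarith [ht.2]⟩)
  let a : ℝ × ℝ ≃ₜ ℝ × ℝ := (Homeomorph.addRight ((c + d) / 2)).prodCongr (Homeomorph.refl ℝ)
  let k : OpenPartialHomeomorph (ℝ × ℝ) M := a.transOpenPartialHomeomorph e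
  have hk : ∀ x : ℝ, k (x, 0) = e (x + (c + d) / 2, 0) := fun x => rfl
  have hkI : ∀ x : ℝ, dist x 0 ≤ (d - c) / 2 → x + (c + d) / 2 ∈ Icc c d := fun x hx => by
    rw [Real.dist_0_eq_abs, abs_le] at hx
    constructor <;> linarith
  have := reach_handle (L := (d - c) / 2 - η) (L' := (d - c) / 2) hO (hA.union hBc) hU
    (union_subset hAU hBU) k (by linarith) (by linarith)
    (fun x hx => hsrc _ (hkI x hx)) (fun x hx => heO _ (hkI x hx))
    (fun x hx hx' => by
      rw [hk]
      have h1 := hkI x hx'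
      rw [Real.dist_0_eq_abs, le_abs] at hx
      rcases hx with hx | hx
      · exact H₂ _ (abs_le.2 ⟨by linarith, by linarith [h1.2]⟩)
      · exact H₁ _ (abs_le.2 ⟨by linarith [h1.1], by linarith⟩))
    (fun x hx => by
      have hx2 := hx
      rw [Real.dist_0_eq_abs, abs_le] at hx
      rw [hk]
      rintro (h | ⟨t, ht, h⟩)
      · exact heA _ ⟨by linarith, by linarith⟩ h
      · have h1 := e.injOn (hsrc _ (hBcd ht)) (hsrc _ (hkI x (by linarith))) h
        have h2 : t = x + (c + d) / 2 := congrArg Prod.fst h1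
        rcases ht with ht | ht
        · linarith [ht.2]
        · linarith [ht.1])
  refine this.mono (union_subset (subset_union_left.trans subset_union_left) ?_)
  rintro _ ⟨t, ht, rfl⟩
  by_cases h1 : t ≤ c + η / 2
  · exact Or.inl (Or.inr ⟨t, Or.inl ⟨ht.1, h1⟩, rfl⟩)
  by_cases h2 : d - η / 2 ≤ t
  · exact Or.inl (Or.inr ⟨t, Or.inr ⟨h2, ht.2⟩, rfl⟩)
  refine Or.inr ⟨t - (c + d) / 2, ?_, ?_⟩
  · show dist _ _ < _
    rw [Real.dist_0_eq_abs, abs_lt]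
    constructor <;> linarith
  · show k _ = _
    rw [hk, sub_add_cancel]

end Segments

section GoodSets

lemma nnreal_dist_zero_eq (x : ℝ≥0) : dist x 0 = x := by
  rw [NNReal.dist_eq, NNReal.coe_zero, sub_zero]
  exact abs_of_nonneg x.2

variable {M : Type*} [MetricSpace M] {O : Set M}

lemma good_segment (hO : IsOpen O) (e : OpenPartialHomeomorph (ℝ × ℝ) M) {a b : ℝ} (hab : a ≤ b)
    (hsrc : ∀ t ∈ Icc a b, (t, (0 : ℝ)) ∈ e.source) (heO : ∀ t ∈ Icc a b, e (t, 0) ∈ O) :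
    Good O ((fun t : ℝ => e (t, 0)) '' Icc a b) := by
  intro A U hA hU hAU
  set f : ℝ → M := fun t => e (t, 0) with hf
  have hcont : ContinuousOn f (Icc a b) := e.continuousOn.comp (by fun_prop) hsrc
  have hinj : InjOn f (Icc a b) := fun x hx y hy hxy =>
    congrArg Prod.fst (e.injOn (hsrc x hx) (hsrc y hy) hxy)
  have hclosed : ∀ c d, a ≤ c → d ≤ b → IsClosed (f '' Icc c d) := fun c d hc hd =>
    (isCompact_Icc.image_of_continuousOn (hcont.mono (Icc_subset_Icc hc hd))).isClosed
  obtain ⟨t, ht0, htm, ⟨m, hm⟩, ht⟩ := exists_monotone_Icc_subset_open_cover_Icc hab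
    (c := fun i : Bool => (Icc a b).domRestrict f ⁻¹' (if i then U else Aᶜ))
    (fun i => by
      refine IsOpen.preimage hcont.domRestrict ?_
      cases i
      · exact hA.isOpen_compl
      · exact hU)
    (fun x _ => by
      rw [mem_iUnion]
      by_cases hx : f x ∈ A
      · exact ⟨true, hAU hx⟩
      · exact ⟨false, hx⟩)
  set s : ℕ → ℝ := fun n => t n with hs
  have hsab : ∀ n, s n ∈ Icc a b := fun n => (t n).2
  have hsm : Monotone s := htm
  have hpiece : ∀ n, f '' Icc (s n) (s (n + 1)) ⊆ U ∨
      ∀ x ∈ Icc (s n) (s (n + 1)), f x ∉ A := by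
    intro n
    have hmem : ∀ x ∈ Icc (s n) (s (n + 1)), x ∈ Icc a b := fun x hx =>
      ⟨(hsab n).1.trans hx.1, hx.2.trans (hsab (n + 1)).2⟩
    obtain ⟨i, hi⟩ := ht n
    cases i
    · exact Or.inr fun x hx => hi (show (⟨x, hmem x hx⟩ : Icc a b) ∈ _ from hx)
    · left
      rintro _ ⟨x, hx, rfl⟩
      exact hi (show (⟨x, hmem x hx⟩ : Icc a b) ∈ _ from hx)
  have hpc : ∀ n, IsClosed (f '' Icc (s n) (s (n + 1))) := fun n =>
    hclosed _ _ (hsab n).1 (hsab (n + 1)).2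
  set G : Set ℕ := {n | n < m ∧ f '' Icc (s n) (s (n + 1)) ⊆ U} with hG
  have hGf : G.Finite := (finite_lt_nat m).subset fun n hn => hn.1
  set A₁ : Set M := A ∪ ⋃ n ∈ G, f '' Icc (s n) (s (n + 1)) with hA₁
  have hA₁c : IsClosed A₁ := hA.union (hGf.isClosed_biUnion fun n _ => hpc n)
  have hA₁U : A₁ ⊆ U := union_subset hAU (iUnion₂_subset fun n hn => hn.2)
  have main : ∀ n ≤ m, Reach O U (A₁ ∪ f '' Icc a (s n)) := by
    intro n
    induction n with
    | zero =>
      intro _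
      have h0 : f '' Icc a (s 0) = {f a} := by
        rw [show s 0 = a from ht0, Icc_self, image_singleton]
      have := (Reach.of_subset (O := O) hU hA₁U).union hA₁c (good_singleton_interior hO e
        (hsrc a ⟨le_rfl, hab⟩) (heO a ⟨le_rfl, hab⟩))
      rwa [closure_singleton, ← show f a = e (a, 0) from rfl, ← h0] at this
    | succ n ih =>
      intro hn
      have hR := ih (by omega)
      have hsplit : Icc a (s (n + 1)) = Icc a (s n) ∪ Icc (s n) (s (n + 1)) :=
        (Icc_union_Icc_eq_Icc (hsab n).1 (hsm n.le_succ)).symm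
      by_cases hnU : f '' Icc (s n) (s (n + 1)) ⊆ U
      · refine hR.mono ?_
        rw [hsplit, image_union, ← union_assoc]
        refine union_subset subset_rfl (Subset.trans ?_ subset_union_left)
        exact (subset_biUnion_of_mem (u := fun n => f '' Icc (s n) (s (n + 1)))
          (show n ∈ G from ⟨by omega, hnU⟩)).trans subset_union_right
      rcases eq_or_lt_of_le (hsm n.le_succ) with heq | hlt
      · rwa [← Nat.succ_eq_add_one, ← heq]
      have hA₂c : IsClosed (A₁ ∪ f '' Icc a (s n)) := hA₁c.union (hclosed _ _ le_rfl (hsab n).2)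
      have hR2 := hR.union hA₂c (good_singleton_interior hO e
        (hsrc _ (hsab (n + 1))) (heO _ (hsab (n + 1))))
      rw [closure_singleton] at hR2
      refine (hR2.trans fun V hV hAV => reach_open_segment hO (hA₂c.union isClosed_singleton) hV hAV
        e hlt ?_ ?_ ?_ ?_ ?_).mono ?_
      · exact fun x hx => hsrc x ⟨(hsab n).1.trans hx.1, hx.2.trans (hsab (n + 1)).2⟩
      · exact fun x hx => heO x ⟨(hsab n).1.trans hx.1, hx.2.trans (hsab (n + 1)).2⟩
      · exact hAV (Or.inl (Or.inr ⟨s n, ⟨(hsab n).1, le_rfl⟩, rfl⟩))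
      · exact hAV (Or.inr rfl)
      · intro x hx
        have hxab : x ∈ Icc a b := ⟨(hsab n).1.trans hx.1.le, hx.2.le.trans (hsab (n + 1)).2⟩
        rintro (((h | h) | ⟨y, hy, h⟩) | h)
        · exact ((hpiece n).resolve_left hnU) x ⟨hx.1.le, hx.2.le⟩ h
        · simp only [mem_iUnion] at h
          obtain ⟨k, hk, y, hy, h⟩ := h
          have hyx : y = x := hinj ⟨(hsab k).1.trans hy.1, hy.2.trans (hsab (k + 1)).2⟩ hxab h
          subst hyx
          rcases lt_trichotomy k n with hkn | rfl | hkn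
          · have := hsm (show k + 1 ≤ n by omega)
            linarith [hx.1, hy.2]
          · exact hnU hk.2
          · have := hsm (show n + 1 ≤ k by omega)
            linarith [hx.2, hy.1]
        · have hyx : y = x := hinj ⟨hy.1, hy.2.trans (hsab n).2⟩ hxab h
          subst hyx
          linarith [hx.1, hy.2]
        · have hxs : x = s (n + 1) := hinj hxab (hsab (n + 1)) h
          linarith [hx.2]
      · rw [hsplit, image_union, ← union_assoc]
        exact union_subset_union_left _ subset_union_left
  rw [(hclosed a b le_rfl le_rfl).closure_eq]
  have := main m le_rfl
  rw [show s m = b from hm m le_rfl] at this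
  exact this.mono (union_subset_union_left _ subset_union_left)

/-- The interior of the half plane as a coordinate chart. -/
def halfPlaneInterior : OpenPartialHomeomorph (ℝ × ℝ) (ℝ≥0 × ℝ) where
  toFun p := (Real.toNNReal p.1, p.2)
  invFun p := (p.1, p.2)
  source := {p | 0 < p.1}
  target := {p | 0 < p.1}
  map_source' p hp := Real.toNNReal_pos.2 hp
  map_target' p hp := NNReal.coe_pos.2 hp
  left_inv' p hp := Prod.ext (Real.coe_toNNReal _ (le_of_lt hp)) rfl
  right_inv' p _ := Prod.ext Real.toNNReal_coe rfl
  open_source := isOpen_lt continuous_const continuous_fst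
  open_target := isOpen_lt continuous_const continuous_fst
  continuousOn_toFun := by fun_prop
  continuousOn_invFun := by fun_prop

lemma halfPlaneInterior_apply (x y : ℝ) :
    halfPlaneInterior (x, y) = (Real.toNNReal x, y) := rfl

lemma mem_trans_source_iff (e : OpenPartialHomeomorph (ℝ≥0 × ℝ) M) {p : ℝ × ℝ} :
    p ∈ (halfPlaneInterior.trans e).source ↔ 0 < p.1 ∧ (Real.toNNReal p.1, p.2) ∈ e.source := by
  rw [OpenPartialHomeomorph.trans_source]
  rfl

lemma good_singleton_boundary (hO : IsOpen O) (e : OpenPartialHomeomorph (ℝ≥0 × ℝ) M)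
    (h0 : (0 : ℝ≥0 × ℝ) ∈ e.source) (h0O : e 0 ∈ O) : Good O {e 0} := by
  intro A U hA hU hAU
  rw [closure_singleton]
  by_cases hx : e 0 ∈ A
  · exact Reach.of_subset hU (union_subset hAU (singleton_subset_iff.2 (hAU hx)))
  have hN : e.source ∩ e ⁻¹' (O ∩ Aᶜ) ∈ 𝓝 (0 : ℝ≥0 × ℝ) :=
    (e.isOpen_inter_preimage (hO.inter hA.isOpen_compl)).mem_nhds ⟨h0, h0O, hx⟩
  obtain ⟨b, hb, hbN⟩ := nhds_basis_closedBall.mem_iff.1 hN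
  have hN' : ∀ x : ℝ≥0, dist x 0 ≤ b → (x, (0 : ℝ)) ∈ e.source ∩ e ⁻¹' (O ∩ Aᶜ) := fun x hx =>
    hbN (by rw [mem_closedBall, Prod.dist_eq]; simpa using hx)
  set b' : ℝ≥0 := Real.toNNReal b with hbb
  have hbc : (b' : ℝ) = b := Real.coe_toNNReal b hb.le
  have hb' : dist b' 0 ≤ b := by rw [nnreal_dist_zero_eq, hbc]
  let e' := halfPlaneInterior.trans e
  have he' : ∀ x : ℝ, e' (x, 0) = e (Real.toNNReal x, 0) := fun x => rfl
  have hes : (b, (0 : ℝ)) ∈ e'.source := by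
    rw [mem_trans_source_iff]
    exact ⟨hb, (hN' b' hb').1⟩
  have hR := (Reach.of_subset (O := O) hU hAU).union hA (good_singleton_interior hO e' hes
    ((hN' b' hb').2.1))
  rw [closure_singleton, he', ← hbb] at hR
  have hA' : IsClosed (A ∪ {e (b', 0)}) := hA.union isClosed_singleton
  refine hR.trans fun V hV hAV => ?_
  obtain ⟨η, hη, H⟩ := exists_pos_ball_mem hV e' hes
    (hAV (Or.inr rfl))
  obtain ⟨η', h1, h2⟩ := exists_between (lt_min hη hb)
  rw [lt_min_iff] at h2
  refine (reach_handle (L := b - η') (L' := b) hO hA' hV hAV e (by linarith) (by linarith)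
    (fun x hx => (hN' x hx).1) (fun x hx => (hN' x hx).2.1) (fun x hx hx' => ?_)
    (fun x hx => ?_)).mono ?_
  · rw [nnreal_dist_zero_eq] at hx hx'
    have := H x (abs_le.2 ⟨by linarith, by linarith⟩)
    rwa [he', Real.toNNReal_coe] at this
  · rintro (h | h)
    · exact (hN' x (by linarith)).2.2 h
    · have h3 : x = b' := congrArg Prod.fst (e.injOn (hN' x (by linarith)).1 (hN' b' hb').1 h)
      rw [h3, nnreal_dist_zero_eq, hbc] at hx
      linarith
  · refine union_subset (subset_union_left.trans subset_union_left) ?_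
    rw [singleton_subset_iff]
    exact Or.inr ⟨0, by show dist _ _ < _; rw [dist_self]; linarith, rfl⟩

lemma good_half_segment (hO : IsOpen O) (e : OpenPartialHomeomorph (ℝ≥0 × ℝ) M) {b : ℝ} (hb : 0 < b)
    (hsrc : ∀ x : ℝ≥0, x ≤ b → (x, (0 : ℝ)) ∈ e.source) (heO : ∀ x : ℝ≥0, x ≤ b → e (x, 0) ∈ O) :
    Good O ((fun x : ℝ≥0 => e (x, 0)) '' {x | x ≤ b}) := by
  intro A U hA hU hAU
  have h0 : (0 : ℝ≥0 × ℝ) ∈ e.source := hsrc 0 (by simpa using hb.le)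
  have hcl : ∀ c ≤ b, IsClosed ((fun x : ℝ≥0 => e (x, 0)) '' {x | x ≤ c}) := by
    intro c hc
    have hball : {x : ℝ≥0 | (x : ℝ) ≤ c} = closedBall 0 c := Set.ext fun x => by
      rw [mem_closedBall, nnreal_dist_zero_eq]
      rfl
    have : IsCompact {x : ℝ≥0 | (x : ℝ) ≤ c} := hball ▸ isCompact_closedBall _ _
    refine (this.image_of_continuousOn ?_).isClosed
    exact e.continuousOn.comp (by fun_prop) fun x hx => hsrc x (le_trans hx hc)
  rw [(hcl b le_rfl).closure_eq]
  have hR := (Reach.of_subset (O := O) hU hAU).union hA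
    (good_singleton_boundary hO e h0 (heO 0 (by simpa using hb.le)))
  rw [closure_singleton] at hR
  refine hR.trans fun V hV hAV => ?_
  have hN : e.source ∩ e ⁻¹' V ∈ 𝓝 (0 : ℝ≥0 × ℝ) :=
    (e.isOpen_inter_preimage hV).mem_nhds ⟨h0, hAV (Or.inr rfl)⟩
  obtain ⟨η', hη', hN'⟩ := nhds_basis_closedBall.mem_iff.1 hN
  obtain ⟨η, hη, hηlt⟩ := exists_between (lt_min hη' hb)
  rw [lt_min_iff] at hηlt
  have hBU : (fun x : ℝ≥0 => e (x, 0)) '' {x | x ≤ η} ⊆ V := by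
    rintro _ ⟨x, hx, rfl⟩
    refine (hN' ?_).2
    rw [mem_closedBall, Prod.dist_eq]
    have hx' : (x : ℝ) ≤ η := hx
    simp only [Prod.fst_zero, Prod.snd_zero, dist_self, nnreal_dist_zero_eq]
    exact max_le (by linarith) hη'.le
  let e' := halfPlaneInterior.trans e
  have he' : ∀ x : ℝ, e' (x, 0) = e (Real.toNNReal x, 0) := fun x => rfl
  have hnn : ∀ x ∈ Icc η b, ((Real.toNNReal x : ℝ≥0) : ℝ) ≤ b := fun x hx => by
    rw [Real.coe_toNNReal _ (hη.le.trans hx.1)]; exact hx.2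
  have hG := good_segment hO e' hηlt.2.le
    (fun x hx => (mem_trans_source_iff e).2 ⟨hη.trans_le hx.1, hsrc _ (hnn x hx)⟩)
    (fun x hx => by rw [he']; exact heO _ (hnn x hx))
  refine ((Reach.of_subset (O := O) hV (union_subset (subset_union_left.trans hAV) hBU)).union
    (hA.union (hcl η hηlt.2.le)) hG).mono ?_
  refine union_subset (subset_union_left.trans subset_union_left) ?_
  rintro _ ⟨x, hx, rfl⟩
  rcases le_total (x : ℝ) η with h | h
  · exact Or.inl (Or.inr ⟨x, h, rfl⟩)
  · exact Or.inr (subset_closure ⟨x, ⟨h, hx⟩, by simp [he']⟩)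

end GoodSets

/-! ### Disks -/

section Disks

variable {M : Type*} [MetricSpace M] {O : Set M}

lemma good_closedBall {E : Type*} [MetricSpace E] [ProperSpace E] [Zero E] [MulActionWithZero ℝ≥0 E]
    [IsBoundedSMul ℝ≥0 E] (e : OpenPartialHomeomorph E M) {r : ℝ}
    (hsrc : closedBall 0 r ⊆ e.source) (heO : e '' closedBall 0 r ⊆ O)
    (hconn : IsPreconnected (ball (0 : E) r)) (hsph : Good O (e '' sphere 0 r)) :
    Good O (e '' closedBall 0 r) := by
  intro A U hA hU hAU
  have hQ : IsCompact (e '' closedBall 0 r) :=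
    (isCompact_closedBall _ _).image_of_continuousOn (e.continuousOn.mono hsrc)
  have hsub : ball (0 : E) r ⊆ e.source := ball_subset_closedBall.trans hsrc
  have hWo : IsOpen (e '' ball 0 r) := e.isOpen_image_of_subset_source isOpen_ball hsub
  have hWc : IsPreconnected (e '' ball 0 r) := hconn.image _ (e.continuousOn.mono hsub)
  have hQW : ∀ x ∈ e '' closedBall 0 r, x ∈ e '' ball 0 r ∨ x ∈ e '' sphere 0 r := by
    rw [← ball_union_sphere, image_union]
    exact fun x hx => hx
  have hdisj : ∀ x ∈ e '' ball 0 r, x ∉ e '' sphere 0 r := by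
    rintro _ ⟨p, hp, rfl⟩ ⟨q, hq, hqp⟩
    have := e.injOn (hsrc (sphere_subset_closedBall hq)) (hsub hp) hqp
    subst this
    exact (ne_of_lt hp) hq
  rw [hQ.isClosed.closure_eq]
  refine (hsph A U hA hU hAU).trans fun V hV hAV => ?_
  have hsV : e '' sphere 0 r ⊆ V := subset_closure.trans (subset_union_right.trans hAV)
  refine ⟨V ∪ e '' ball 0 r, hV.union hWo, union_subset
    ((subset_union_left.trans hAV).trans subset_union_left) fun x hx => ?_, ?_⟩
  · exact (hQW x hx).elim Or.inr fun h => Or.inl (hsV h)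
  have hF : IsCompact (e '' closedBall 0 r \ V) := hQ.diff hV
  have hFW : e '' closedBall 0 r \ V ⊆ e '' ball 0 r := fun x hx =>
    (hQW x hx.1).resolve_right fun h => hx.2 (hsV h)
  obtain ⟨δ, hδ, hδW⟩ := hF.exists_thickening_subset_open hWo hFW
  intro ε hε
  refine ⟨min δ ε, lt_min hδ hε, fun h hh hf => ?_⟩
  have hWQ : e '' ball 0 r ⊆ e '' closedBall 0 r := image_mono ball_subset_closedBall
  have hmaps : h '' (e '' ball 0 r) ⊆ e '' ball 0 r := by
    rintro _ ⟨x, hx, rfl⟩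
    by_cases hxV : x ∈ V
    · rwa [hf x hxV]
    · exact hδW (mem_thickening_iff.2 ⟨x, ⟨hWQ hx, hxV⟩,
        (hh x (heO (hWQ hx))).trans_le (min_le_left _ _)⟩)
  have hWW : h '' (e '' ball 0 r) = e '' ball 0 r := by
    refine hmaps.antisymm ?_
    rcases (e '' ball 0 r).eq_empty_or_nonempty with hemp | ⟨x, hx⟩
    · rw [hemp]; exact empty_subset _
    refine hWc.subset_of_closure_inter_subset (h.isOpen_image.2 hWo)
      ⟨h x, hmaps (mem_image_of_mem h hx), mem_image_of_mem h hx⟩ ?_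
    rintro y ⟨hy, hyW⟩
    obtain ⟨q, hq, rfl⟩ := closure_minimal (image_mono hWQ) (hQ.image h.continuous).isClosed hy
    rcases hQW q hq with hq' | hq'
    · exact mem_image_of_mem h hq'
    · rw [hf q (hsV hq')] at hyW
      exact (hdisj q hyW hq').elim
  obtain ⟨k, hk1, hk2⟩ := exists_restrict h hWo hF.isClosed hFW
    (fun x hx hxF => hf x (by_contra fun hxV => hxF ⟨hWQ hx, hxV⟩)) hWW
  have hkQ : ∀ y ∉ e '' closedBall 0 r, k y = y := fun y hy => hk2 y fun h => hy (hWQ h)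
  refine ⟨k.symm, (isotopicToId_of_fixed_off_image_closedBall e hsrc k hkQ).symm,
    fun x hx => symm_fixed_off k hkQ x fun h => hx (heO h), fun y => ?_, ?_⟩
  · obtain ⟨z, rfl⟩ := k.surjective y
    rw [k.symm_apply_apply, dist_comm]
    by_cases hz : z ∈ e '' ball 0 r
    · rw [hk1 z hz]
      exact (hh z (heO (hWQ hz))).trans_le (min_le_right _ _)
    · rw [hk2 z hz, dist_self]
      exact hε
  · intro x hx
    rw [Homeomorph.symm_apply_eq]
    by_cases hxW : x ∈ e '' ball 0 r
    · rw [hk1 x hxW]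
    · rw [hk2 x hxW, hf x (hx.resolve_right hxW)]

lemma isPreconnected_ball_prod {X : Type*} [MetricSpace X] [Zero X] {r : ℝ}
    (h : IsPreconnected (ball (0 : X) r)) : IsPreconnected (ball (0 : X × ℝ) r) := by
  rw [← Prod.mk_zero_zero, ← ball_prod_same]
  exact h.prod (convex_ball _ _).isPreconnected

lemma good_square_interior (hO : IsOpen O) (e : OpenPartialHomeomorph (ℝ × ℝ) M) {r : ℝ}
    (hr : 0 < r) (hsrc : closedBall 0 r ⊆ e.source) (heO : e '' closedBall 0 r ⊆ O) :
    Good O (e '' closedBall 0 r) := by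
  refine good_closedBall e hsrc heO
    (isPreconnected_ball_prod (convex_ball _ _).isPreconnected) ?_
  have hmem : ∀ x y : ℝ, |x| ≤ r → |y| ≤ r → (x, y) ∈ closedBall (0 : ℝ × ℝ) r := fun x y hx hy => by
    rw [mem_closedBall, Prod.dist_eq]
    simpa using ⟨hx, hy⟩
  have h1 : ∀ s : ℝ, |s| = r → Good O ((fun t : ℝ => e (t, s)) '' Icc (-r) r) := fun s hs => by
    have := good_segment hO ((vtrans ℝ s).transOpenPartialHomeomorph e) (neg_le_self hr.le)
      (fun t ht => by
        show ((t, (0 : ℝ) + s) : ℝ × ℝ) ∈ e.source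
        rw [zero_add]
        exact hsrc (hmem _ _ (abs_le.2 ht) hs.le))
      (fun t ht => by
        show e (t, (0 : ℝ) + s) ∈ O
        rw [zero_add]
        exact heO (mem_image_of_mem e (hmem _ _ (abs_le.2 ht) hs.le)))
    convert this using 2 with t
    show e (t, s) = e (t, (0 : ℝ) + s)
    rw [zero_add]
  have h2 : ∀ s : ℝ, |s| = r → Good O ((fun t : ℝ => e (s, t)) '' Icc (-r) r) := fun s hs => by
    have := good_segment hO (((vtrans ℝ s).trans
        (Homeomorph.prodComm ℝ ℝ)).transOpenPartialHomeomorph e) (neg_le_self hr.le)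
      (fun t ht => by
        show (((0 : ℝ) + s, t) : ℝ × ℝ) ∈ e.source
        rw [zero_add]
        exact hsrc (hmem _ _ hs.le (abs_le.2 ht)))
      (fun t ht => by
        show e ((0 : ℝ) + s, t) ∈ O
        rw [zero_add]
        exact heO (mem_image_of_mem e (hmem _ _ hs.le (abs_le.2 ht))))
    convert this using 2 with t
    show e (s, t) = e ((0 : ℝ) + s, t)
    rw [zero_add]
  have hr' : |r| = r := abs_of_pos hr
  have hr'' : |-r| = r := by rw [abs_neg, hr']
  refine (((h1 r hr').union (h1 (-r) hr'')).union ((h2 r hr').union (h2 (-r) hr''))).mono ?_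
  rw [← Prod.mk_zero_zero, sphere_prod]
  rintro _ ⟨⟨x, y⟩, ⟨hx, hy⟩ | ⟨hx, hy⟩, rfl⟩
  · have hy' : y ∈ Icc (-r) r := by simpa [abs_le] using hy
    rcases eq_or_eq_neg_of_abs_eq (show |x| = r by simpa using hx) with rfl | rfl
    · exact Or.inr (Or.inl ⟨y, hy', rfl⟩)
    · exact Or.inr (Or.inr ⟨y, hy', rfl⟩)
  · have hx' : x ∈ Icc (-r) r := by simpa [abs_le] using hx
    rcases eq_or_eq_neg_of_abs_eq (show |y| = r by simpa using hy) with rfl | rfl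
    · exact Or.inl (Or.inl ⟨x, hx', rfl⟩)
    · exact Or.inl (Or.inr ⟨x, hx', rfl⟩)

lemma good_square_boundary (hO : IsOpen O) (e : OpenPartialHomeomorph (ℝ≥0 × ℝ) M) {r : ℝ}
    (hr : 0 < r) (hsrc : closedBall 0 r ⊆ e.source) (heO : e '' closedBall 0 r ⊆ O) :
    Good O (e '' closedBall 0 r) := by
  have hball : ball (0 : ℝ≥0) r = Iio (Real.toNNReal r) := Set.ext fun x => by
    rw [mem_ball, nnreal_dist_zero_eq, mem_Iio, Real.lt_toNNReal_iff_coe_lt]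
  refine good_closedBall e hsrc heO (isPreconnected_ball_prod ?_) ?_
  · rw [hball]
    exact ordConnected_Iio.isPreconnected
  have hmem : ∀ (x : ℝ≥0) (y : ℝ), x ≤ r → |y| ≤ r → (x, y) ∈ closedBall (0 : ℝ≥0 × ℝ) r :=
    fun x y hx hy => by
      rw [mem_closedBall, Prod.dist_eq, Prod.fst_zero, Prod.snd_zero, nnreal_dist_zero_eq]
      exact max_le hx (by simpa using hy)
  have h1 : ∀ s : ℝ, |s| = r → Good O ((fun x : ℝ≥0 => e (x, s)) '' {x | x ≤ r}) := fun s hs => by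
    have := good_half_segment hO ((vtrans ℝ≥0 s).transOpenPartialHomeomorph e) hr
      (fun t ht => by
        show ((t, (0 : ℝ) + s) : ℝ≥0 × ℝ) ∈ e.source
        rw [zero_add]
        exact hsrc (hmem _ _ ht hs.le))
      (fun t ht => by
        show e (t, (0 : ℝ) + s) ∈ O
        rw [zero_add]
        exact heO (mem_image_of_mem e (hmem _ _ ht hs.le)))
    convert this using 2 with t
    show e (t, s) = e (t, (0 : ℝ) + s)
    rw [zero_add]
  set r' : ℝ≥0 := Real.toNNReal r with hr'
  have hrr : (r' : ℝ) = r := Real.coe_toNNReal r hr.le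
  have h2 : Good O ((fun t : ℝ => e (r', t)) '' Icc (-r) r) := by
    have := good_segment hO (((vtrans ℝ r).trans
        (Homeomorph.prodComm ℝ ℝ)).transOpenPartialHomeomorph (halfPlaneInterior.trans e))
      (neg_le_self hr.le)
      (fun t ht => by
        show (((0 : ℝ) + r, t) : ℝ × ℝ) ∈ (halfPlaneInterior.trans e).source
        rw [zero_add, mem_trans_source_iff]
        exact ⟨hr, hsrc (hmem _ _ hrr.le (abs_le.2 ht))⟩)
      (fun t ht => by
        show e (Real.toNNReal ((0 : ℝ) + r), t) ∈ O
        rw [zero_add]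
        exact heO (mem_image_of_mem e (hmem _ _ hrr.le (abs_le.2 ht))))
    convert this using 2 with t
    show e (r', t) = e (Real.toNNReal ((0 : ℝ) + r), t)
    rw [zero_add]
  refine (((h1 r (abs_of_pos hr)).union (h1 (-r) (by rw [abs_neg, abs_of_pos hr]))).union h2).mono ?_
  rw [← Prod.mk_zero_zero, sphere_prod]
  rintro _ ⟨⟨x, y⟩, ⟨hx, hy⟩ | ⟨hx, hy⟩, rfl⟩
  · have hy' : y ∈ Icc (-r) r := by simpa [abs_le] using hy
    have hx' : (x : ℝ) = r := by rw [← nnreal_dist_zero_eq]; exact hx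
    exact Or.inr ⟨y, hy', by rw [hr', ← hx', Real.toNNReal_coe]⟩
  · have hx' : (x : ℝ) ≤ r := by rw [← nnreal_dist_zero_eq]; exact hx
    rcases eq_or_eq_neg_of_abs_eq (show |y| = r by simpa using hy) with rfl | rfl
    · exact Or.inl (Or.inl ⟨x, hx', rfl⟩)
    · exact Or.inl (Or.inr ⟨x, hx', rfl⟩)

lemma exists_good_nhds (hO : IsOpen O) (e : OpenPartialHomeomorph (ℝ≥0 × ℝ) M) {p : ℝ≥0 × ℝ}
    (hp : p ∈ e.source) (hpO : e p ∈ O) : ∃ N ∈ 𝓝 (e p), Good O N := by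
  by_cases h : p.1 = 0
  · let c := (vtrans ℝ≥0 p.2).transOpenPartialHomeomorph e
    have h0 : vtrans ℝ≥0 p.2 0 = p := Prod.ext h.symm (zero_add _)
    have hc0 : c 0 = e p := congrArg e h0
    have hcs : (0 : ℝ≥0 × ℝ) ∈ c.source := by
      show vtrans ℝ≥0 p.2 0 ∈ e.source
      rwa [h0]
    obtain ⟨r, hr, hrN⟩ := nhds_basis_closedBall.mem_iff.1
      ((c.isOpen_inter_preimage hO).mem_nhds ⟨hcs, show c 0 ∈ O by rwa [hc0]⟩)
    rw [← hc0]
    exact ⟨_, c.image_mem_nhds hcs (closedBall_mem_nhds _ hr), good_square_boundary hO c hr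
      (fun x hx => (hrN hx).1) (image_subset_iff.2 fun x hx => (hrN hx).2)⟩
  · have hpos : 0 < p.1 := pos_iff_ne_zero.2 h
    let a : ℝ × ℝ ≃ₜ ℝ × ℝ := Homeomorph.addRight ((p.1 : ℝ), p.2)
    let c := a.transOpenPartialHomeomorph (halfPlaneInterior.trans e)
    have h0 : a 0 = ((p.1 : ℝ), p.2) := zero_add _
    have hc0 : c 0 = e p := by
      show e (halfPlaneInterior (a 0)) = e p
      rw [h0, halfPlaneInterior_apply, Real.toNNReal_coe]
    have hcs : (0 : ℝ × ℝ) ∈ c.source := by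
      show a 0 ∈ (halfPlaneInterior.trans e).source
      rw [h0, mem_trans_source_iff]
      exact ⟨hpos, by rwa [Real.toNNReal_coe]⟩
    obtain ⟨r, hr, hrN⟩ := nhds_basis_closedBall.mem_iff.1
      ((c.isOpen_inter_preimage hO).mem_nhds ⟨hcs, show c 0 ∈ O by rwa [hc0]⟩)
    rw [← hc0]
    exact ⟨_, c.image_mem_nhds hcs (closedBall_mem_nhds _ hr), good_square_interior hO c hr
      (fun x hx => (hrN hx).1) (image_subset_iff.2 fun x hx => (hrN hx).2)⟩

/-- Homeomorphisms of a surface close to the identity near a compact set can be corrected there. -/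
theorem good_of_isCompact_of_subset
    (hM : ∀ x : M, ∃ e : OpenPartialHomeomorph (ℝ≥0 × ℝ) M, x ∈ e.target) {D : Set M}
    (hO : IsOpen O) (hD : IsCompact D) (hDO : D ⊆ O) : Good O D :=
  good_of_isCompact hD fun x hx => by
    obtain ⟨e, he⟩ := hM x
    have := exists_good_nhds hO e (e.map_target he) (by rw [e.right_inv he]; exact hDO hx)
    rwa [e.right_inv he] at this

end Disks

/-! ### Gluing over a sequence of pieces -/

section Layers

variable {M : Type*} [MetricSpace M]

lemma exists_isotopicToId_of_fixed_off [WeaklyLocallyCompactSpace M]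
    (hM : ∀ x : M, ∃ e : OpenPartialHomeomorph (ℝ≥0 × ℝ) M, x ∈ e.target) {D : Set M}
    (hD : IsCompact D) :
    ∃ η > 0, ∀ f : M ≃ₜ M, (∀ x ∉ D, f x = x) → (∀ x, dist (f x) x < η) → IsotopicToId f := by
  obtain ⟨D', hD', hDD'⟩ := exists_compact_superset hD
  obtain ⟨V, -, hAV, hV⟩ := good_of_isCompact_of_subset hM isOpen_univ hD' (subset_univ D')
    (interior D')ᶜ Dᶜ isOpen_interior.isClosed_compl hD.isClosed.isOpen_compl
    (compl_subset_compl.2 hDD')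
  obtain ⟨η, hη, H⟩ := hV 1 one_pos
  refine ⟨η, hη, fun f hf hd => ?_⟩
  obtain ⟨g, hg, -, -, hfix⟩ := H f (fun x _ => hd x) hf
  refine hg.of_trans (.of_eq_id fun x => hfix x (hAV ?_))
  by_cases hx : x ∈ interior D'
  · exact Or.inr (subset_closure (interior_subset hx))
  · exact Or.inl hx

lemma image_eq_of_fixed_off {h : M ≃ₜ M} {W F : Set M} (hfix : ∀ x ∈ W, x ∉ F → h x = x)
    (hmaps : ∀ x ∈ F, h x ∈ W) (hdisj : ∀ x, h x ∈ W → x ∈ W) : h '' W = W := by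
  ext y
  constructor
  · rintro ⟨x, hx, rfl⟩
    by_cases hxF : x ∈ F
    · exact hmaps x hxF
    · rwa [hfix x hx hxF]
  · intro hy
    obtain ⟨x, rfl⟩ := h.surjective y
    exact ⟨x, hdisj x hy, rfl⟩

/-- Small homeomorphisms supported in a discrete family of compact sets are isotopic to the identity
as soon as their support is compact. -/
lemma exists_isotopicToId_of_fixed_off_family [WeaklyLocallyCompactSpace M]
    (hM : ∀ x : M, ∃ e : OpenPartialHomeomorph (ℝ≥0 × ℝ) M, x ∈ e.target) {W F : ℕ → Set M}
    (hW : ∀ k, IsOpen (W k)) (hdisj : Pairwise (Function.onFun Disjoint W))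
    (hF : ∀ k, IsCompact (F k)) (hFW : ∀ k, F k ⊆ W k) :
    ∃ η : ℕ → ℝ, (∀ k, 0 < η k) ∧ ∀ h : M ≃ₜ M, (∀ x, (∀ k, x ∉ F k) → h x = x) →
      (∀ k, ∀ x ∈ F k, dist (h x) x < η k) → (∃ n, ∀ k ≥ n, ∀ x ∈ F k, h x = x) →
      IsotopicToId h := by
  choose a ha Ha using fun k => exists_isotopicToId_of_fixed_off hM (hF k)
  choose r hr Hr using fun k => (hF k).exists_thickening_subset_open (hW k) (hFW k)
  refine ⟨fun k => min (a k) (r k), fun k => lt_min (ha k) (hr k), ?_⟩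
  rintro h hfix hd ⟨n, hn⟩
  induction n generalizing h with
  | zero =>
    refine .of_eq_id fun x => ?_
    by_cases hx : ∃ k, x ∈ F k
    · obtain ⟨k, hk⟩ := hx
      exact hn k (Nat.zero_le _) x hk
    · exact hfix x fun k hk => hx ⟨k, hk⟩
  | succ n ih =>
    have hmaps : ∀ k, ∀ x ∈ F k, h x ∈ W k := fun k x hx => Hr k (mem_thickening_iff.2
      ⟨x, hx, (hd k x hx).trans_le (min_le_right _ _)⟩)
    have hne : ∀ {k l x}, x ∈ W k → x ∈ W l → k = l := fun {k l x} hk hl => by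
      by_contra hkl
      exact disjoint_left.1 (hdisj hkl) hk hl
    have hback : ∀ x, h x ∈ W n → x ∈ W n := fun x hx => by
      by_cases hk : ∃ k, x ∈ F k
      · obtain ⟨k, hk⟩ := hk
        rw [hne hx (hmaps k x hk)]
        exact hFW k hk
      · rwa [hfix x fun k hx => hk ⟨k, hx⟩] at hx
    have hfixW : ∀ x ∈ W n, x ∉ F n → h x = x := fun x hx hxF =>
      hfix x fun k hk => hxF (by rwa [← hne (hFW k hk) hx])
    obtain ⟨g, hgW, hgW'⟩ := exists_restrict h (hW n) (hF n).isClosed (hFW n) hfixW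
      (image_eq_of_fixed_off hfixW (hmaps n) hback)
    have hgF : ∀ x ∉ F n, g x = x := fun x hx => by
      by_cases hxW : x ∈ W n
      · rw [hgW x hxW, hfixW x hxW hx]
      · exact hgW' x hxW
    have hg : IsotopicToId g := Ha n g hgF fun x => by
      by_cases hx : x ∈ F n
      · rw [hgW x (hFW n hx)]
        exact (hd n x hx).trans_le (min_le_left _ _)
      · rw [hgF x hx, dist_self]; exact ha n
    have hW1 : ∀ x ∈ W n, g.symm (h x) = x := fun x hx => by
      rw [← hgW x hx, g.symm_apply_apply]
    have hW2 : ∀ x ∉ W n, g.symm (h x) = h x := fun x hx => by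
      rw [g.symm_apply_eq, hgW' _ fun h' => hx (hback x h')]
    refine hg.symm.of_trans (ih (h.trans g.symm) (fun x hx => ?_) (fun k x hx => ?_)
      fun k hk x hx => ?_)
    · by_cases hxW : x ∈ W n
      · exact hW1 x hxW
      · exact (hW2 x hxW).trans (hfix x hx)
    · by_cases hxW : x ∈ W n
      · show dist (g.symm (h x)) x < _
        rw [hW1 x hxW, dist_self]
        exact lt_min (ha k) (hr k)
      · show dist (g.symm (h x)) x < _
        rw [hW2 x hxW]
        exact hd k x hx
    · by_cases hxW : x ∈ W n
      · exact hW1 x hxW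
      · refine (hW2 x hxW).trans (hn k ?_ x hx)
        rcases hk.lt_or_eq with h' | rfl
        · exact h'
        · exact absurd (hFW _ hx) hxW

/-- Simultaneous correction near a sequence of compact sets with disjoint neighborhoods. -/
lemma exists_simultaneous_correction
    (hM : ∀ x : M, ∃ e : OpenPartialHomeomorph (ℝ≥0 × ℝ) M, x ∈ e.target) {O D : ℕ → Set M}
    (hO : ∀ k, IsOpen (O k)) (hdisj : Pairwise (Function.onFun Disjoint O))
    (hD : ∀ k, IsCompact (D k)) (hDO : ∀ k, D k ⊆ O k) :
    ∃ U : ℕ → Set M, (∀ k, IsOpen (U k)) ∧ (∀ k, D k ⊆ U k) ∧ (∀ k, U k ⊆ O k) ∧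
      ∀ ε : ℕ → ℝ, (∀ k, 0 < ε k) → ∃ δ : ℕ → ℝ, (∀ k, 0 < δ k) ∧ ∀ h : M ≃ₜ M,
        (∀ k, ∀ x ∈ O k, dist (h x) x < δ k) → (∃ n, ∀ k ≥ n, ∀ x ∈ O k, h x = x) →
        ∃ g : M ≃ₜ M, IsotopicToId g ∧ (∀ y, (∀ k, y ∉ O k) → g y = y) ∧
          (∀ k, ∀ y ∈ O k, dist (g y) y < ε k) ∧ ∀ k, ∀ x ∈ U k, g (h x) = x := by
  have hgood : ∀ k, Reach (O k) ∅ (∅ ∪ closure (D k)) := fun k =>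
    good_of_isCompact_of_subset hM (hO k) (hD k) (hDO k) ∅ ∅ isClosed_empty isOpen_empty
      (Subset.refl _)
  choose V hV hDV HV using hgood
  have hDV' : ∀ k, D k ⊆ V k := fun k => subset_closure.trans (subset_union_right.trans (hDV k))
  have hne : ∀ {k l x}, x ∈ O k → x ∈ O l → k = l := fun {k l x} hk hl => by
    by_contra hkl
    exact disjoint_left.1 (hdisj hkl) hk hl
  refine ⟨fun k => V k ∩ O k, fun k => (hV k).inter (hO k), fun k => subset_inter (hDV' k) (hDO k),
    fun k => inter_subset_right, fun ε hε => ?_⟩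
  choose δ hδ Hδ using fun k => HV k (ε k) (hε k)
  refine ⟨δ, hδ, ?_⟩
  rintro h hd ⟨n, hn⟩
  choose c hc hcO hcd hcV using fun k => Hδ k h (hd k) (fun x hx => absurd hx (notMem_empty x))
  have key : ∀ n, ∃ g : M ≃ₜ M, IsotopicToId g ∧ (∀ y, (∀ k < n, y ∉ O k) → g y = y) ∧
      (∀ k < n, ∀ y ∈ O k, g y = c k y) := by
    intro n
    induction n with
    | zero => exact ⟨_, .refl, fun _ _ => rfl, fun k hk => absurd hk (Nat.not_lt_zero k)⟩
    | succ n ih =>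
      obtain ⟨g, hg, hg1, hg2⟩ := ih
      refine ⟨(c n).trans g, (hc n).trans hg, fun y hy => ?_, fun k hk y hy => ?_⟩
      · show g (c n y) = y
        rw [hcO n y (hy n n.lt_succ_self), hg1 y fun k hk => hy k (hk.trans n.lt_succ_self)]
      · show g (c n y) = c k y
        rcases Nat.lt_succ_iff_lt_or_eq.1 hk with hk | rfl
        · rw [hcO n y fun h' => hk.ne (hne hy h'), hg2 k hk y hy]
        · have := mapsTo_of_fixed_off (c k) (hcO k) hy
          exact hg1 _ fun l hl h' => hl.ne (hne h' this)
  obtain ⟨g, hg, hg1, hg2⟩ := key n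
  refine ⟨g, hg, fun y hy => hg1 y fun k _ => hy k, fun k y hy => ?_, fun k x hx => ?_⟩
  · by_cases hk : k < n
    · rw [hg2 k hk y hy]; exact hcd k y
    · rw [hg1 y fun l hl h' => hk (by rwa [hne hy h']), dist_self]
      exact hε k
  · by_cases hk : k < n
    · have hxc := hcV k x hx.1
      have : h x ∈ O k := by
        by_contra h'
        rw [hcO k _ h'] at hxc
        exact h' (hxc.symm ▸ hx.2 : h x ∈ O k)
      rw [hg2 k hk _ this, hxc]
    · rw [hn k (not_lt.1 hk) x hx.2]
      exact hg1 x fun l hl h' => hk (by rwa [hne hx.2 h'])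

end Layers

section NearIdentity

variable {M : Type*} [MetricSpace M]

lemma pairwise_disjoint_interior_sdiff {K : CompactExhaustion M} {a b : ℕ → ℕ}
    (hab : ∀ {k l}, k < l → a k ≤ b l) :
    Pairwise (Function.onFun Disjoint fun k => interior (K (a k)) \ K (b k)) := by
  intro k l hkl
  rcases lt_or_gt_of_ne hkl with h | h
  · exact disjoint_left.2 fun x hx hx' => hx'.2 (K.subset (hab h) (interior_subset hx.1))
  · exact disjoint_left.2 fun x hx hx' => hx.2 (K.subset (hab h) (interior_subset hx'.1))

lemma isOpen_setOf_forall_mem_dist_lt {φ : M → M} (hφ : Continuous φ) {C : ℕ → Set M}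
    (hC : ∀ k, IsClosed (C k)) (hfin : LocallyFinite C) (ζ : ℕ → ℝ) :
    IsOpen {p : M × M | ∀ k, p.1 ∈ C k → dist p.2 (φ p.1) < ζ k} := by
  have : {p : M × M | ∀ k, p.1 ∈ C k → dist p.2 (φ p.1) < ζ k} =
      (⋃ k, {p : M × M | p.1 ∈ C k} ∩ {p : M × M | ζ k ≤ dist p.2 (φ p.1)})ᶜ := by
    ext p
    simp
  rw [this]
  refine (LocallyFinite.isClosed_iUnion ?_ fun k => ?_).isOpen_compl
  · exact (hfin.preimage_continuous continuous_fst).subset fun k => inter_subset_left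
  · exact ((hC k).preimage continuous_fst).inter
      (isClosed_le continuous_const (by fun_prop))

lemma IsotopicToId.exists_isCompact {g : M ≃ₜ M} (hg : IsotopicToId g) :
    ∃ S : Set M, IsCompact S ∧ ∀ x ∉ S, g x = x := by
  obtain ⟨F, -, -, h0, -, S, hS, hF⟩ := hg
  exact ⟨S, hS, fun x hx => by rw [← h0, hF x hx]⟩

/-- Compactly supported homeomorphisms of a surface that are close to the identity in the Whitney
topology are isotopic to the identity with compact support. -/
theorem exists_open_isotopicToId [WeaklyLocallyCompactSpace M] [SigmaCompactSpace M]
    (hM : ∀ x : M, ∃ e : OpenPartialHomeomorph (ℝ≥0 × ℝ) M, x ∈ e.target) :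
    ∃ V : Set (M × M), IsOpen V ∧ (∀ x, (x, x) ∈ V) ∧ ∀ h : M ≃ₜ M, (∀ x, (x, h x) ∈ V) →
      (∃ S : Set M, IsCompact S ∧ ∀ x ∉ S, h x = x) → IsotopicToId h := by
  let K : CompactExhaustion M := (CompactExhaustion.choice M).shiftr
  have hK0 : K 0 = ∅ := rfl
  let O : ℕ → Set M := fun k => interior (K (4 * k + 3)) \ K (4 * k)
  let D : ℕ → Set M := fun k => K (4 * k + 2) \ interior (K (4 * k + 1))
  let W : ℕ → Set M := fun k => interior (K (4 * k + 1)) \ K (4 * k - 2)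
  have hO : ∀ k, IsOpen (O k) := fun k => isOpen_interior.sdiff (K.isCompact _).isClosed
  have hW : ∀ k, IsOpen (W k) := fun k => isOpen_interior.sdiff (K.isCompact _).isClosed
  have hD : ∀ k, IsCompact (D k) := fun k => (K.isCompact _).diff isOpen_interior
  have hDO : ∀ k, D k ⊆ O k := fun k x hx =>
    ⟨K.subset_interior (by omega) hx.1, fun h' => hx.2 (K.subset_interior (by omega) h')⟩
  have hOdisj : Pairwise (Function.onFun Disjoint O) :=
    pairwise_disjoint_interior_sdiff (a := fun k => 4 * k + 3) (b := fun k => 4 * k)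
      (by omega)
  have hWdisj : Pairwise (Function.onFun Disjoint W) :=
    pairwise_disjoint_interior_sdiff (a := fun k => 4 * k + 1) (b := fun k => 4 * k - 2)
      (by omega)
  obtain ⟨U, hU, hDU, hUO, HU⟩ := exists_simultaneous_correction hM hO hOdisj hD hDO
  let F : ℕ → Set M := fun k => (K (4 * k + 1) \ interior (K (4 * k - 2))) \ ⋃ j, U j
  have hF : ∀ k, IsCompact (F k) := fun k =>
    ((K.isCompact _).diff isOpen_interior).diff (isOpen_iUnion hU)
  have hFW : ∀ k, F k ⊆ W k := by
    rintro k x ⟨⟨h1, h2⟩, h3⟩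
    rw [mem_iUnion, not_exists] at h3
    refine ⟨?_, fun h' => ?_⟩
    · by_contra h4
      exact h3 k (hDU k ⟨K.subset (by omega) h1, h4⟩)
    · rcases k with _ | k
      · exact h'
      · refine h3 k (hDU k ⟨K.subset (by omega) h', fun h5 => h2 ?_⟩)
        exact interior_mono (K.subset (by omega)) h5
  have hcover : ∀ x, (∀ k, x ∉ F k) → ∃ j, x ∈ U j := by
    intro x hx
    by_contra hxU
    have hxU' : x ∉ ⋃ j, U j := by rwa [mem_iUnion]
    obtain ⟨m, hm⟩ : ∃ m, K.find x = m := ⟨_, rfl⟩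
    have h1 : x ∈ K m := hm ▸ K.mem_find x
    have h2 : ∀ n, x ∈ K n → m ≤ n := fun n hn => hm ▸ K.mem_iff_find_le.1 hn
    by_cases hk : m ≤ 4 * (m / 4) + 1
    · refine hx (m / 4) ⟨⟨K.subset hk h1, fun h' => ?_⟩, hxU'⟩
      have := h2 _ (interior_subset h')
      have h0 : m = 0 := by omega
      subst h0
      rw [hK0] at h1
      exact h1
    · by_cases hk2 : m = 4 * (m / 4) + 2
      · refine hxU ⟨m / 4, hDU _ ⟨hk2 ▸ h1, fun h' => ?_⟩⟩
        have := h2 _ (interior_subset h')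
        omega
      · refine hx (m / 4 + 1) ⟨⟨K.subset (by omega) h1, fun h' => ?_⟩, hxU'⟩
        have := h2 _ (interior_subset h')
        omega
  obtain ⟨η, hη, Hη⟩ := exists_isotopicToId_of_fixed_off_family hM hW hWdisj hF hFW
  choose r hr Hr using fun k => (hF k).exists_thickening_subset_open (hW k) (hFW k)
  let ε : ℕ → ℝ := fun j => min (η j) (η (j + 1)) / 2
  have hε : ∀ j, 0 < ε j := fun j => half_pos (lt_min (hη _) (hη _))
  obtain ⟨δ, hδ, Hδ⟩ := HU ε hε
  let C : ℕ → Set M := fun k => K (4 * k + 3) \ interior (K (4 * k - 3))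
  let ζ : ℕ → ℝ := fun k => min (δ k) (min (r k) (η k / 2))
  have hζ : ∀ k, 0 < ζ k := fun k => lt_min (hδ k) (lt_min (hr k) (half_pos (hη k)))
  have hCfin : LocallyFinite C := fun x => by
    obtain ⟨n, hn⟩ := K.exists_mem_nhds x
    refine ⟨interior (K n), interior_mem_nhds.2 hn, (finite_le_nat n).subset ?_⟩
    rintro k ⟨y, hy, hyn⟩
    by_contra hk
    rw [Set.mem_ofPred_eq, not_le] at hk
    exact hy.2 (interior_mono (K.subset (by omega)) hyn)
  refine ⟨{p : M × M | ∀ k, p.1 ∈ C k → dist p.2 p.1 < ζ k}, isOpen_setOf_forall_mem_dist_lt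
    continuous_id (fun k => (K.isCompact _).isClosed.sdiff isOpen_interior) hCfin ζ, fun x k _ => by
      rw [dist_self]; exact hζ k, ?_⟩
  rintro h hh ⟨S, hS, hSh⟩
  have hh' : ∀ x k, x ∈ C k → dist (h x) x < ζ k := fun x k => hh x k
  have hOC : ∀ k, O k ⊆ C k := fun k x hx =>
    ⟨interior_subset hx.1, fun h' => hx.2 (K.subset (by omega) (interior_subset h'))⟩
  have hFC : ∀ k, F k ⊆ C k := fun k x hx =>
    ⟨K.subset (by omega) hx.1.1, fun h' => hx.1.2 (interior_mono (K.subset (by omega)) h')⟩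
  have hCout : ∀ T : Set M, IsCompact T → ∃ n, ∀ k ≥ n, ∀ x ∈ C k, x ∉ T := by
    intro T hT
    obtain ⟨n, hn⟩ := K.exists_superset_of_isCompact hT
    exact ⟨n + 1, fun k hk x hx hxT => hx.2 (K.subset_interior (by omega) (hn hxT))⟩
  obtain ⟨n, hn⟩ := hCout S hS
  obtain ⟨g, hg, hgO, hgε, hgU⟩ := Hδ h
    (fun k x hx => (hh' x k (hOC k hx)).trans_le (min_le_left _ _))
    ⟨n, fun k hk x hx => hSh x (hn k hk x (hOC k hx))⟩
  obtain ⟨T, hT, hTg⟩ := hg.exists_isCompact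
  obtain ⟨m, hm⟩ := hCout (S ∪ T) (hS.union hT)
  refine hg.of_trans (Hη (h.trans g) (fun x hx => ?_) (fun k x hx => ?_) ⟨m, fun k hk x hx => ?_⟩)
  · obtain ⟨j, hj⟩ := hcover x hx
    exact hgU j x hj
  · have hd := hh' x k (hFC k hx)
    have hd1 : dist (h x) x < r k := hd.trans_le ((min_le_right _ _).trans (min_le_left _ _))
    have hd2 : dist (h x) x < η k / 2 := hd.trans_le ((min_le_right _ _).trans (min_le_right _ _))
    have hhW : h x ∈ W k := Hr k (mem_thickening_iff.2 ⟨x, hx, hd1⟩)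
    have hgd : dist (g (h x)) (h x) < η k / 2 := by
      by_cases hj : ∃ j, h x ∈ O j
      · obtain ⟨j, hj⟩ := hj
        refine (hgε j _ hj).trans_le (div_le_div_of_nonneg_right ?_ zero_le_two)
        have h1 : k ≤ j + 1 := by
          by_contra h'
          exact hhW.2 (K.subset (by omega) (interior_subset hj.1))
        have h2 : j ≤ k := by
          by_contra h'
          exact hj.2 (K.subset (by omega) (interior_subset hhW.1))
        rcases h2.lt_or_eq with h2 | rfl
        · obtain rfl : k = j + 1 := by omega
          exact min_le_right _ _
        · exact min_le_left _ _
      · rw [hgO _ fun k hk => hj ⟨k, hk⟩, dist_self]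
        exact half_pos (hη k)
    show dist (g (h x)) x < η k
    linarith [dist_triangle (g (h x)) (h x) x]
  · have hx' := hm k hk x (hFC k hx)
    show g (h x) = x
    rw [hSh x fun h' => hx' (Or.inl h'), hTg x fun h' => hx' (Or.inr h')]

end NearIdentity

/-! ### The identity component -/

section Whitney

lemma isOpen_setOf_graph_subset {M : Type*} [TopologicalSpace M] {U : Set (M × M)}
    (hU : IsOpen U) : IsOpen {f : M ≃ₜ M | ∀ x, (x, f x) ∈ U} :=
  TopologicalSpace.isOpen_generateFrom_of_mem ⟨U, hU, rfl⟩

theorem IsotopicToId.mem_H0 {M : Type*} [TopologicalSpace M] {h : M ≃ₜ M}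
    (hh : IsotopicToId h) : h ∈ H0 M := by
  obtain ⟨F, hF, hF', h0, h1, K, hK, hFK⟩ := hh
  choose γ hγ using hF'
  have hcont : Continuous γ := by
    refine continuous_generateFrom_iff.2 ?_
    rintro _ ⟨U, hU, rfl⟩
    refine isOpen_iff_mem_nhds.2 fun t ht => ?_
    have ht' : ∀ x, (x, F (x, t)) ∈ U := fun x => by rw [hγ]; exact ht x
    have key : ∀ᶠ s in 𝓝 t, ∀ x ∈ K, (x, F (x, s)) ∈ U :=
      hK.eventually_forall_of_forall_eventually fun x _ =>
        (by fun_prop : Continuous fun z : unitInterval × M => (z.2, F (z.2, z.1))).continuousAt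
          |>.eventually_mem (hU.mem_nhds (ht' x))
    filter_upwards [key] with s hs x
    rw [← hγ]
    by_cases hx : x ∈ K
    · exact hs x hx
    · have := ht' x
      rwa [hFK x hx] at this ⊢
  have e0 : γ 0 = h := Homeomorph.ext fun x => by rw [← hγ, h0]
  have e1 : γ 1 = Homeomorph.refl M := Homeomorph.ext fun x => by rw [← hγ, h1]; rfl
  exact (isPreconnected_range hcont).subset_connectedComponent ⟨1, e1⟩ ⟨0, e0⟩

variable {M : Type*} [MetricSpace M] [WeaklyLocallyCompactSpace M] [SigmaCompactSpace M]

theorem exists_isCompact_of_mem_H0 {h : M ≃ₜ M} (hh : h ∈ H0 M) :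
    ∃ S : Set M, IsCompact S ∧ ∀ x ∉ S, h x = x := by
  by_contra! hS
  let K := CompactExhaustion.choice M
  choose x hxK hx using fun n => hS (K n) (K.isCompact n)
  let a : ℕ → ℝ := fun n => dist (h (x n)) (x n)
  have ha : ∀ n, 0 < a n := fun n => dist_pos.2 (hx n)
  let B : Set (M ≃ₜ M) := {f | Tendsto (fun n => dist (f (x n)) (x n) / a n) atTop (𝓝 0)}
  have hfin : LocallyFinite fun n => ({x n} : Set M) := fun y => by
    obtain ⟨n, hn⟩ := K.exists_mem_nhds y
    refine ⟨K n, hn, (finite_lt_nat n).subset ?_⟩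
    rintro k ⟨_, rfl, hk⟩
    by_contra hkn
    exact hxK k (K.subset (not_lt.1 hkn) hk)
  let N : (M ≃ₜ M) → Set (M ≃ₜ M) := fun f =>
    {f' | ∀ n, dist (f' (x n)) (f (x n)) < a n / (n + 1)}
  have hN : ∀ f, N f ∈ 𝓝 f := fun f => by
    have := isOpen_setOf_graph_subset (isOpen_setOf_forall_mem_dist_lt f.continuous
      (fun _ => isClosed_singleton) hfin fun n => a n / (n + 1))
    refine mem_of_superset (this.mem_nhds fun y n _ => ?_) fun f' hf' n => hf' (x n) n rfl
    show dist (f y) (f y) < _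
    rw [dist_self]
    have := ha n
    positivity
  have hNB : ∀ f, ∀ f' ∈ N f, (f' ∈ B ↔ f ∈ B) := fun f f' hf' => by
    have : Tendsto (fun n => dist (f' (x n)) (x n) / a n - dist (f (x n)) (x n) / a n)
        atTop (𝓝 0) := by
      refine squeeze_zero_norm (fun n => ?_) tendsto_one_div_add_atTop_nhds_zero_nat
      rw [← sub_div, norm_div, Real.norm_of_nonneg (ha n).le, div_le_iff₀ (ha n), Real.norm_eq_abs,
        one_div_mul_eq_div]
      exact (abs_dist_sub_le _ _ _).trans (hf' n).le
    constructor
    · intro h'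
      have := Tendsto.sub h' this
      simp only [sub_sub_cancel, sub_zero] at this
      exact this
    · intro h'
      have := Tendsto.add this h'
      simp only [sub_add_cancel, zero_add] at this
      exact this
  have hB : IsClopen B := ⟨isOpen_compl_iff.1 (isOpen_iff_mem_nhds.2 fun f hf =>
      mem_of_superset (hN f) fun f' hf' => mt (hNB f f' hf').1 hf),
    isOpen_iff_mem_nhds.2 fun f hf => mem_of_superset (hN f) fun f' hf' => (hNB f f' hf').2 hf⟩
  have hB1 : Homeomorph.refl M ∈ B := by simp [B]
  have : Tendsto (fun n => a n / a n) atTop (𝓝 0) := hB.connectedComponent_subset hB1 hh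
  simp only [div_self (ha _).ne', tendsto_const_nhds_iff] at this
  exact one_ne_zero this

theorem isotopicToId_of_mem_H0
    (hM : ∀ x : M, ∃ e : OpenPartialHomeomorph (ℝ≥0 × ℝ) M, x ∈ e.target) {h : M ≃ₜ M}
    (hh : h ∈ H0 M) : IsotopicToId h := by
  obtain ⟨V, hV, hdiag, HV⟩ := exists_open_isotopicToId hM
  let N : (M ≃ₜ M) → Set (M ≃ₜ M) := fun f => {f' | ∀ x, (x, f.symm (f' x)) ∈ V}
  have hN : ∀ f, IsOpen (N f) := fun f =>
    isOpen_setOf_graph_subset (U := (fun p : M × M => (p.1, f.symm p.2)) ⁻¹' V)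
      (hV.preimage (by fun_prop))
  have hself : ∀ f, f ∈ N f := fun f x => by rw [f.symm_apply_apply]; exact hdiag x
  have key : ∀ f ∈ H0 M, ∀ f' ∈ H0 M, f' ∈ N f → (IsotopicToId f ↔ IsotopicToId f') := by
    intro f hf f' hf' hff'
    obtain ⟨S, hS, hSf⟩ := exists_isCompact_of_mem_H0 hf
    obtain ⟨T, hT, hTf⟩ := exists_isCompact_of_mem_H0 hf'
    have : IsotopicToId (f'.trans f.symm) := HV _ hff' ⟨S ∪ T, hS.union hT, fun x hx => by
      rw [mem_union, not_or] at hx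
      show f.symm (f' x) = x
      rw [hTf x hx.2, symm_fixed_off f hSf x hx.1]⟩
    constructor
    · exact fun hi => hi.symm.of_trans this
    · intro hi
      have h' := (hi.symm.trans this).symm
      rwa [show (f'.symm.trans (f'.trans f.symm)).symm = f from
        Homeomorph.ext fun x => by simp] at h'
  by_contra hni
  obtain ⟨f', hf', h1, h2⟩ := isPreconnected_connectedComponent
    (⋃ f ∈ {f ∈ H0 M | IsotopicToId f}, N f) (⋃ f ∈ {f ∈ H0 M | ¬ IsotopicToId f}, N f)
    (isOpen_biUnion fun f _ => hN f) (isOpen_biUnion fun f _ => hN f)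
    (fun f hf => (em (IsotopicToId f)).imp (fun hi => mem_biUnion ⟨hf, hi⟩ (hself f))
      fun hi => mem_biUnion ⟨hf, hi⟩ (hself f))
    ⟨_, mem_connectedComponent, mem_biUnion ⟨mem_connectedComponent, .refl⟩ (hself _)⟩
    ⟨h, hh, mem_biUnion ⟨hh, hni⟩ (hself h)⟩
  simp only [mem_iUnion] at h1 h2
  obtain ⟨f, ⟨hf, hfi⟩, hff⟩ := h1
  obtain ⟨k, ⟨hk, hki⟩, hkf⟩ := h2
  exact hki ((key k hk f' hf' hkf).2 ((key f hf f' hf' hff).1 hfi))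

end Whitney

/-- The half plane as a product. -/
def halfPlaneHomeo : EuclideanHalfSpace 2 ≃ₜ ℝ≥0 × ℝ where
  toFun x := (⟨x.1 0, x.2⟩, x.1 1)
  invFun p := ⟨!₂[(p.1 : ℝ), p.2], p.1.2⟩
  left_inv x := by
    refine Subtype.ext (PiLp.ext fun i => ?_)
    fin_cases i <;> rfl
  right_inv p := rfl
  continuous_toFun := by
    have : Continuous fun x : EuclideanHalfSpace 2 => x.1 := continuous_subtype_val
    exact (Continuous.subtype_mk (by fun_prop) _).prodMk (by fun_prop)
  continuous_invFun := by
    refine Continuous.subtype_mk ?_ _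
    refine (PiLp.continuous_toLp 2 _).comp (continuous_pi fun i => ?_)
    fin_cases i
    · exact NNReal.continuous_coe.comp continuous_fst
    · exact continuous_snd

end WhitneyHomeo

end

variable (M : Type*) [TopologicalSpace M] [T2Space M] [SigmaCompactSpace M]
  [ChartedSpace (EuclideanHalfSpace 2) M] [ConnectedSpace M]

/-- A homeomorphism `h` of a σ-compact non-compact connected 2-manifold `M` belongs to
the identity component `𝓗₀(M)` of `𝓗(M)` with the Whitney topology if and only if there
is an isotopy `F : M × [0,1] → M` from `h` to the identity with compact support. -/
theorem mem_H0_iff_compactly_supported_isotopy (hnc : ¬ CompactSpace M) (h : M ≃ₜ M) :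
    h ∈ H0 M ↔
      ∃ F : M × unitInterval → M, Continuous F ∧
        (∀ t : unitInterval, ∃ g : M ≃ₜ M, ∀ x : M, F (x, t) = g x) ∧
        (∀ x : M, F (x, 0) = h x) ∧ (∀ x : M, F (x, 1) = x) ∧
        ∃ K : Set M, IsCompact K ∧ ∀ x : M, x ∉ K → ∀ t : unitInterval, F (x, t) = x := by
  refine ⟨fun hh => ?_, WhitneyHomeo.IsotopicToId.mem_H0⟩
  have : LocallyCompactSpace (EuclideanHalfSpace 2) :=
    WhitneyHomeo.halfPlaneHomeo.isClosedEmbedding.locallyCompactSpace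
  have : SecondCountableTopology (EuclideanHalfSpace 2) :=
    WhitneyHomeo.halfPlaneHomeo.isEmbedding.secondCountableTopology
  have := ChartedSpace.locallyCompactSpace (EuclideanHalfSpace 2) M
  have := ChartedSpace.secondCountable_of_sigmaCompact (EuclideanHalfSpace 2) M
  let _ := TopologicalSpace.metrizableSpaceMetric M
  refine WhitneyHomeo.isotopicToId_of_mem_H0 (fun x => ⟨(WhitneyHomeo.halfPlaneHomeo.symm
    |>.toOpenPartialHomeomorph.trans (chartAt (EuclideanHalfSpace 2) x).symm), ?_⟩) hh
  rw [OpenPartialHomeomorph.trans_target]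
  exact ⟨mem_chart_source (EuclideanHalfSpace 2) x, Set.mem_univ _⟩

end
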